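/- Let k be a field of characteristic zero and H a finite-dimensional Hopf algebra over k that is semisimple as a ring and carries a triangular structure: an invertible element R ∈ H ⊗ H such that (Δ ⊗ id)(R) = R₁₃R₂₃, (id ⊗ Δ)(R) = R₁₃R₁₂, R Δ(x) = (τ ∘ Δ)(x) R for all x ∈ H (where τ is the flip of tensor factors), and R₂₁R = 1 ⊗ 1 (where R₂₁ = τ(R)). Then exp(H) is finite and divides dim_k(H). -/

import Mathlib

open TensorProduct

noncomputable section

variable (k H : Type*) [CommSemiring k] [Semiring H] [Bialgebra k H]

/-- Convolution product of two linear endomorphisms of a bialgebra: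
`(f ⋆ g)(x) = ∑ f(x⁽¹⁾) g(x⁽²⁾)`, i.e. `m ∘ (f ⊗ g) ∘ Δ`. -/
def conv (f g : H →ₗ[k] H) : H →ₗ[k] H :=
  LinearMap.mul' k H ∘ₗ TensorProduct.map f g ∘ₗ Coalgebra.comul

/-- `expMap k H Sinv n` is the map `m_n ∘ (id ⊗ Sinv² ⊗ Sinv⁴ ⊗ ⋯ ⊗ Sinv^{2n-2}) ∘ Δ_n`
(defined by the recursion `m_1 = Δ_1 = id`, `m_n = m ∘ (m_{n-1} ⊗ id)`,
`Δ_n = (Δ_{n-1} ⊗ id) ∘ Δ`). -/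
def expMap (Sinv : H →ₗ[k] H) : ℕ → (H →ₗ[k] H)
  | 0 => 0
  | 1 => LinearMap.id
  | (n+2) => conv k H (expMap Sinv (n+1)) ((Sinv ∘ₗ Sinv) ^ (n+1))

/-- The map `x ↦ ε(x)·1`. -/
def counitUnit : H →ₗ[k] H := Algebra.linearMap k H ∘ₗ Coalgebra.counit

/-- The exponent of a Hopf algebra (with `Sinv` the inverse of the antipode):
the least `n > 0` with `m_n ∘ (id ⊗ S⁻² ⊗ ⋯ ⊗ S^{-2n+2}) ∘ Δ_n = ε(·)1`.
By convention `hopfExponent = 0` when no such `n` exists (i.e. `exp(H) = ∞`). -/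
def hopfExponent (Sinv : H →ₗ[k] H) : ℕ :=
  sInf {n : ℕ | 0 < n ∧ expMap k H Sinv n = counitUnit k H}

section ptr
variable {K A Y : Type*} [Field K] [AddCommGroup A] [Module K A] [FiniteDimensional K A]
  [AddCommGroup Y] [Module K Y] [FiniteDimensional K Y]

def ptr (K A Y : Type*) [Field K] [AddCommGroup A] [Module K A] [FiniteDimensional K A]
  [AddCommGroup Y] [Module K Y] [FiniteDimensional K Y] :
    Module.End K (A ⊗[K] Y) →ₗ[K] Module.End K Y :=
  (TensorProduct.lid K (Module.End K Y)).toLinearMap ∘ₗ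
    (LinearMap.rTensor (Module.End K Y) (LinearMap.trace K A)) ∘ₗ
    (homTensorHomEquiv K A Y A Y).symm.toLinearMap

theorem ptr_map (f : Module.End K A) (g : Module.End K Y) :
    ptr K A Y (TensorProduct.map f g) = LinearMap.trace K A f • g := by
  have : (homTensorHomEquiv K A Y A Y).symm (TensorProduct.map f g) = f ⊗ₜ g := by
    rw [LinearEquiv.symm_apply_eq, homTensorHomEquiv_apply, TensorProduct.homTensorHomMap_apply]
  simp [ptr, this]

theorem end_induction {P : Module.End K (A ⊗[K] Y) → Prop}
    (h0 : P 0) (hm : ∀ f g, P (TensorProduct.map f g)) (ha : ∀ x y, P x → P y → P (x + y))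
    (x) : P x := by
  obtain ⟨t, rfl⟩ := (homTensorHomEquiv K A Y A Y).surjective x
  induction t using TensorProduct.induction_on with
  | zero => simpa using h0
  | tmul f g => simpa [homTensorHomEquiv_apply] using hm f g
  | add x y hx hy => simpa using ha _ _ hx hy

theorem ptr_lT_mul (f : Module.End K Y) (B : Module.End K (A ⊗[K] Y)) :
    ptr K A Y (LinearMap.lTensor A f * B) = f * ptr K A Y B := by
  induction B using end_induction with
  | h0 => simp
  | hm g h =>
    rw [LinearMap.lTensor, Module.End.mul_eq_comp, ← TensorProduct.map_comp, ptr_map, ptr_map]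
    simp [Module.End.mul_eq_comp]
  | ha x y hx hy => simp only [mul_add, map_add, hx, hy]

theorem ptr_mul_lT (f : Module.End K Y) (B : Module.End K (A ⊗[K] Y)) :
    ptr K A Y (B * LinearMap.lTensor A f) = ptr K A Y B * f := by
  induction B using end_induction with
  | h0 => simp
  | hm g h =>
    rw [LinearMap.lTensor, Module.End.mul_eq_comp, ← TensorProduct.map_comp, ptr_map, ptr_map]
    simp [Module.End.mul_eq_comp]
  | ha x y hx hy => simp only [add_mul, map_add, hx, hy]

theorem trace_ptr (B : Module.End K (A ⊗[K] Y)) :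
    LinearMap.trace K Y (ptr K A Y B) = LinearMap.trace K _ B := by
  induction B using end_induction with
  | h0 => simp
  | hm g h => rw [ptr_map, LinearMap.trace_tensorProduct']; simp
  | ha x y hx hy => simp only [map_add, hx, hy]

theorem ptr_one : ptr K A Y 1 = (Module.finrank K A : K) • (1 : Module.End K Y) := by
  have := ptr_map (K := K) (1 : Module.End K A) (1 : Module.End K Y)
  rwa [TensorProduct.map_one, LinearMap.trace_one] at this
end ptr

section act
variable {K A B M : Type*} [Field K] [Ring A] [Algebra K A] [Ring B] [Algebra K B]
  [AddCommGroup M] [Module K M]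

def act (φ : B →ₐ[K] Module.End K M) : A ⊗[K] B →ₐ[K] Module.End K (A ⊗[K] M) :=
  (Module.endTensorEndAlgHom (R := K) (A := K) (M := A) (N := M)).comp
    (Algebra.TensorProduct.map (Algebra.lmul K A) φ)

theorem act_tmul (φ : B →ₐ[K] Module.End K M) (a : A) (b : B) :
    act φ (a ⊗ₜ[K] b) = TensorProduct.map (LinearMap.mulLeft K a) (φ b) := by
  rw [act, AlgHom.comp_apply, Algebra.TensorProduct.map_tmul]
  exact Module.endTensorEndAlgHom_apply _ _

theorem act_one_tmul (φ : B →ₐ[K] Module.End K M) (b : B) :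
    act φ ((1 : A) ⊗ₜ[K] b) = LinearMap.lTensor A (φ b) := by
  rw [act_tmul]; ext; simp

def rho1 (K A Y : Type*) [Field K] [Ring A] [Algebra K A]
  [AddCommGroup Y] [Module K Y] : A →ₐ[K] Module.End K (A ⊗[K] Y) :=
  (Module.End.rTensorAlgHom K A Y).comp (Algebra.lmul K A)

theorem rho1_apply (K A Y : Type*) [Field K] [Ring A] [Algebra K A]
  [AddCommGroup Y] [Module K Y] (a : A) : rho1 K A Y a = LinearMap.rTensor Y (LinearMap.mulLeft K a) := by
  ext; rfl
end act

section lemM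
universe v
variable {K : Type*} {A : Type v} [Field K] [Ring A] [Algebra K A]

def rho2 (K A Y : Type*) [Field K] [Ring A] [Algebra K A]
  [AddCommGroup Y] [Module K Y] : A ⊗[K] A →ₐ[K] Module.End K (A ⊗[K] (A ⊗[K] Y)) :=
  act (rho1 K A Y)

def sg (K A Y : Type*) [Field K] [AddCommGroup A] [Module K A]
  [AddCommGroup Y] [Module K Y] : Module.End K (A ⊗[K] (A ⊗[K] Y)) :=
  (TensorProduct.leftComm K A A Y).toLinearMap

def cc (Y : Type*) [AddCommGroup Y] [Module K Y] (R : A ⊗[K] A) :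
    Module.End K (A ⊗[K] (A ⊗[K] Y)) := sg K A Y * rho2 K A Y R

/-- multiplication in `A ⊗ Aᵒᵖ` -/
def kop (K A : Type*) [Field K] [Ring A] [Algebra K A] :
    A ⊗[K] A →ₗ[K] A ⊗[K] A →ₗ[K] A ⊗[K] A :=
  TensorProduct.lift ((TensorProduct.mapBilinear (RingHom.id K) A A A A).compl₁₂
    (LinearMap.mul K A) (LinearMap.mul K A).flip)

theorem kop_tmul (p q r s : A) :
    kop K A (p ⊗ₜ q) (r ⊗ₜ s) = (p * r) ⊗ₜ (s * q) := by
  simp [kop]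

variable (Y : Type*) [AddCommGroup Y] [Module K Y]

theorem rho2_tmul (a b : A) : rho2 K A Y (a ⊗ₜ b) =
    TensorProduct.map (LinearMap.mulLeft K a) (LinearMap.rTensor Y (LinearMap.mulLeft K b)) := by
  rw [rho2, act_tmul, rho1_apply]

theorem sg_sg : sg K A Y * sg K A Y = 1 := by
  ext; simp [sg]

theorem sg_rho2 (x : A ⊗[K] A) :
    sg K A Y * rho2 K A Y x = rho2 K A Y (TensorProduct.comm K A A x) * sg K A Y := by
  induction x using TensorProduct.induction_on with
  | zero => simp
  | add x y hx hy => simp only [map_add, mul_add, add_mul, hx, hy]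
  | tmul a b =>
    rw [TensorProduct.comm_tmul, rho2_tmul, rho2_tmul]
    ext; simp [sg]

theorem cc_cc (R : A ⊗[K] A) (h : TensorProduct.comm K A A R * R = 1) :
    cc Y R * cc Y R = 1 := by
  have : cc Y R * cc Y R = sg K A Y * (sg K A Y * rho2 K A Y (TensorProduct.comm K A A R)
      * rho2 K A Y R) := by
    rw [cc, mul_assoc, ← mul_assoc (rho2 K A Y R)]
    rw [sg_rho2 Y (TensorProduct.comm K A A R)]
    congr 3
    simp
  rw [this, mul_assoc, ← map_mul, h, map_one, mul_one, sg_sg]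

theorem cc_lT (R : A ⊗[K] A) (f : Module.End K Y) :
    Commute (cc Y R) (LinearMap.lTensor A (LinearMap.lTensor A f)) := by
  rw [cc, commute_iff_eq]
  have h1 : sg K A Y * LinearMap.lTensor A (LinearMap.lTensor A f) =
      LinearMap.lTensor A (LinearMap.lTensor A f) * sg K A Y := by ext; simp [sg]
  have h2 : rho2 K A Y R * LinearMap.lTensor A (LinearMap.lTensor A f) =
      LinearMap.lTensor A (LinearMap.lTensor A f) * rho2 K A Y R := by
    induction R using TensorProduct.induction_on with
    | zero => simp
    | add x y hx hy => simp only [map_add, mul_add, add_mul, hx, hy]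
    | tmul a b => rw [rho2_tmul]; ext; simp
  rw [mul_assoc, h2, ← mul_assoc, h1, mul_assoc]

def rho3 (K A Y : Type*) [Field K] [Ring A] [Algebra K A]
  [AddCommGroup Y] [Module K Y] : A ⊗[K] (A ⊗[K] A) →ₐ[K] Module.End K (A ⊗[K] (A ⊗[K] (A ⊗[K] Y))) :=
  act (rho2 K A Y)

def i12 (K A : Type*) [Field K] [Ring A] [Algebra K A] : A ⊗[K] A →ₗ[K] A ⊗[K] (A ⊗[K] A) :=
  LinearMap.lTensor A ((TensorProduct.mk K A A).flip 1)
def i13 (K A : Type*) [Field K] [Ring A] [Algebra K A] : A ⊗[K] A →ₗ[K] A ⊗[K] (A ⊗[K] A) :=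
  LinearMap.lTensor A (TensorProduct.mk K A A 1)
def i23 (K A : Type*) [Field K] [Ring A] [Algebra K A] : A ⊗[K] A →ₗ[K] A ⊗[K] (A ⊗[K] A) :=
  TensorProduct.mk K A (A ⊗[K] A) 1

theorem rho3_tmul (a b c : A) : rho3 K A Y (a ⊗ₜ (b ⊗ₜ c)) =
    TensorProduct.map (LinearMap.mulLeft K a) (TensorProduct.map (LinearMap.mulLeft K b)
      (LinearMap.rTensor Y (LinearMap.mulLeft K c))) := by
  rw [rho3, act_tmul, rho2_tmul]

theorem rho2_eq_12 (x : A ⊗[K] A) : rho2 K A (A ⊗[K] Y) x = rho3 K A Y (i12 K A x) := by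
  induction x using TensorProduct.induction_on with
  | zero => simp
  | add x y hx hy => simp only [map_add, hx, hy]
  | tmul a b => simp only [i12, LinearMap.lTensor_tmul, LinearMap.flip_apply, mk_apply, rho3_tmul, rho2_tmul]
                ext; simp

theorem lT_rho2_eq_23 (x : A ⊗[K] A) :
    LinearMap.lTensor A (rho2 K A Y x) = rho3 K A Y (i23 K A x) := by
  rw [i23, mk_apply, rho3, act_one_tmul]

theorem s1_12 (x : A ⊗[K] A) : sg K A (A ⊗[K] Y) * rho3 K A Y (i23 K A x) =
    rho3 K A Y (i13 K A x) * sg K A (A ⊗[K] Y) := by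
  induction x using TensorProduct.induction_on with
  | zero => simp
  | add x y hx hy => simp only [map_add, mul_add, add_mul, hx, hy]
  | tmul a b => simp only [i13, i23, LinearMap.lTensor_tmul, mk_apply, rho3_tmul]
                ext; simp [sg]

theorem s1_13 (x : A ⊗[K] A) : sg K A (A ⊗[K] Y) * rho3 K A Y (i13 K A x) =
    rho3 K A Y (i23 K A x) * sg K A (A ⊗[K] Y) := by
  induction x using TensorProduct.induction_on with
  | zero => simp
  | add x y hx hy => simp only [map_add, mul_add, add_mul, hx, hy]
  | tmul a b => simp only [i13, i23, LinearMap.lTensor_tmul, mk_apply, rho3_tmul]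
                ext; simp [sg]

theorem s2_12 (x : A ⊗[K] A) : LinearMap.lTensor A (sg K A Y) * rho3 K A Y (i12 K A x) =
    rho3 K A Y (i13 K A x) * LinearMap.lTensor A (sg K A Y) := by
  induction x using TensorProduct.induction_on with
  | zero => simp
  | add x y hx hy => simp only [map_add, mul_add, add_mul, hx, hy]
  | tmul a b => simp only [i13, i12, LinearMap.lTensor_tmul, LinearMap.flip_apply, mk_apply, rho3_tmul]
                ext; simp [sg]

theorem s2_13 (x : A ⊗[K] A) : LinearMap.lTensor A (sg K A Y) * rho3 K A Y (i13 K A x) =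
    rho3 K A Y (i12 K A x) * LinearMap.lTensor A (sg K A Y) := by
  induction x using TensorProduct.induction_on with
  | zero => simp
  | add x y hx hy => simp only [map_add, mul_add, add_mul, hx, hy]
  | tmul a b => simp only [i13, i12, LinearMap.lTensor_tmul, LinearMap.flip_apply, mk_apply, rho3_tmul]
                ext; simp [sg]

theorem sg_braid : sg K A (A ⊗[K] Y) * LinearMap.lTensor A (sg K A Y) * sg K A (A ⊗[K] Y) =
    LinearMap.lTensor A (sg K A Y) * sg K A (A ⊗[K] Y) * LinearMap.lTensor A (sg K A Y) := by
  ext; simp [sg]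

theorem braid_aux {E : Type*} [Monoid E] {s1 s2 r12 r13 r23 : E}
    (h1 : s1 * r23 = r13 * s1) (h2 : s1 * r13 = r23 * s1)
    (h3 : s2 * r12 = r13 * s2) (h4 : s2 * r13 = r12 * s2) (hs : s1 * s2 * s1 = s2 * s1 * s2)
    (hy : r12 * r13 * r23 = r23 * r13 * r12) :
    (s1 * r12) * (s2 * r23) * (s1 * r12) = (s2 * r23) * (s1 * r12) * (s2 * r23) := by
  calc (s1 * r12) * (s2 * r23) * (s1 * r12) = s1 * (r12 * s2) * r23 * s1 * r12 := by
        simp only [mul_assoc]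
    _ = s1 * s2 * r13 * (r23 * s1) * r12 := by rw [← h4]; simp only [mul_assoc]
    _ = s1 * s2 * (r13 * s1) * r13 * r12 := by rw [← h2]; simp only [mul_assoc]
    _ = (s1 * s2 * s1) * (r23 * r13 * r12) := by rw [← h1]; simp only [mul_assoc]
    _ = (s2 * s1 * s2) * (r12 * r13 * r23) := by rw [hs, hy]
    _ = s2 * s1 * (s2 * r12) * r13 * r23 := by simp only [mul_assoc]
    _ = s2 * (s1 * r13) * (s2 * r13) * r23 := by rw [h3]; simp only [mul_assoc]
    _ = _ := by rw [h4, h2]; simp only [mul_assoc]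

theorem cc_braid (R : A ⊗[K] A)
    (hy : i12 K A R * i13 K A R * i23 K A R = i23 K A R * i13 K A R * i12 K A R) :
    cc (A ⊗[K] Y) R * LinearMap.lTensor A (cc Y R) * cc (A ⊗[K] Y) R =
    LinearMap.lTensor A (cc Y R) * cc (A ⊗[K] Y) R * LinearMap.lTensor A (cc Y R) := by
  have e : LinearMap.lTensor A (cc Y R) =
      LinearMap.lTensor A (sg K A Y) * rho3 K A Y (i23 K A R) := by
    rw [cc, LinearMap.lTensor_mul, lT_rho2_eq_23]
  have hy3 : rho3 K A Y (i12 K A R) * rho3 K A Y (i13 K A R) * rho3 K A Y (i23 K A R) =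
      rho3 K A Y (i23 K A R) * rho3 K A Y (i13 K A R) * rho3 K A Y (i12 K A R) := by
    rw [← map_mul, ← map_mul, hy, map_mul, map_mul]
  rw [e, cc, rho2_eq_12]
  exact braid_aux (E := Module.End K (A ⊗[K] (A ⊗[K] (A ⊗[K] Y)))) (s1_12 Y R) (s1_13 Y R) (s2_12 Y R) (s2_13 Y R) (sg_braid (K := K) (A := A) Y)
    hy3

variable [FiniteDimensional K A] [FiniteDimensional K Y]

theorem ptr_cc (R : A ⊗[K] A) (hk : kop K A R (TensorProduct.comm K A A R) = 1)
    (B : Module.End K (A ⊗[K] Y)) :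
    ptr K A (A ⊗[K] Y) (cc Y R * LinearMap.lTensor A B * cc Y R) =
      LinearMap.lTensor A (ptr K A Y B) := by
  induction B using end_induction with
  | h0 => simp
  | ha x y hx hy => simp only [LinearMap.lTensor_add, map_add, mul_add, add_mul, hx, hy]
  | hm f g =>
    have key : ∀ x y : A ⊗[K] A,
        ptr K A (A ⊗[K] Y) (sg K A Y * rho2 K A Y x *
          LinearMap.lTensor A (TensorProduct.map f g) * (sg K A Y * rho2 K A Y y)) =
        TensorProduct.lift ((LinearMap.lsmul K (Module.End K (A ⊗[K] Y))).flip.compl₁₂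
          ((TensorProduct.mapBilinear (RingHom.id K) A Y A Y).flip g ∘ₗ (LinearMap.mul K A))
          (LinearMap.trace K A ∘ₗ (LinearMap.mulLeft K f) ∘ₗ (LinearMap.mul K A)))
          (kop K A x (TensorProduct.comm K A A y)) := by
      intro x y
      induction x using TensorProduct.induction_on with
      | zero => simp
      | add x y hx hy => simp only [map_add, mul_add, add_mul, hx, hy, LinearMap.add_apply]
      | tmul a b =>
        induction y using TensorProduct.induction_on with
        | zero => simp
        | add x y hx hy => simp only [map_add, mul_add, hx, hy]
        | tmul a' b' =>
          rw [TensorProduct.comm_tmul, kop_tmul, rho2_tmul, rho2_tmul]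
          have : (sg K A Y * map (LinearMap.mulLeft K a) (LinearMap.rTensor Y (LinearMap.mulLeft K b)) * LinearMap.lTensor A (map f g) *
            (sg K A Y * map (LinearMap.mulLeft K a') (LinearMap.rTensor Y (LinearMap.mulLeft K b')))) =
            map (LinearMap.mulLeft K b * f * LinearMap.mulLeft K a') (map (LinearMap.mulLeft K (a * b')) g) := by
            ext; simp [sg, mul_assoc]
          rw [this, ptr_map]
          have h2 : LinearMap.trace K A (LinearMap.mulLeft K b * f * LinearMap.mulLeft K a') =
              LinearMap.trace K A (f * LinearMap.mulLeft K (a' * b)) := by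
            rw [mul_assoc, LinearMap.trace_mul_comm, mul_assoc, LinearMap.mulLeft_mul]
            rfl
          rw [h2]
          rfl
    rw [cc, key, hk, ptr_map, Algebra.TensorProduct.one_def]
    ext a y
    have h1 : LinearMap.mul K A 1 = 1 := by ext; simp
    simp [h1]
end lemM

section lemM3
universe v

theorem nat_dvd_of_pow {d N t : ℕ} (ht : t ≠ 0) (hd : d ≠ 0) (h : ∀ m : ℕ, ∃ r : ℕ, r * d ^ m = N ^ m * t) :
    d ∣ N := by
  rcases Nat.eq_zero_or_pos N with rfl | hN
  · simp
  rw [← Nat.factorization_prime_le_iff_dvd hd hN.ne']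
  intro p hp
  by_contra hlt
  push Not at hlt
  obtain ⟨r, hr⟩ := h t
  have h1 : d ^ t ∣ N ^ t * t := ⟨r, by rw [← hr, mul_comm]⟩
  have h2 := (Nat.factorization_le_iff_dvd (pow_ne_zero t hd)
    (mul_ne_zero (pow_ne_zero t hN.ne') ht)).2 h1 p
  rw [Nat.factorization_mul (pow_ne_zero t hN.ne') ht, Nat.factorization_pow, Nat.factorization_pow] at h2
  simp only [Finsupp.smul_apply, Finsupp.add_apply, smul_eq_mul] at h2
  have h3 : t.factorization p < t := Nat.factorization_lt p ht
  nlinarith [Nat.zero_le t]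

theorem t2_step {E : Type*} [Monoid E] {c1 c2 a : E} (h1 : c1 * c1 = 1) (h2 : c2 * c2 = 1)
    (hb : c1 * c2 * c1 = c2 * c1 * c2) (ha : Commute c1 a) (hab : Commute a (c2 * a * c2)) :
    Commute (c2 * a * c2) (c1 * (c2 * a * c2) * c1) := by
  have conj : ∀ c x y : E, c * c = 1 → Commute x y → Commute (c * x * c) (c * y * c) := by
    intro c x y hc hxy
    have e : ∀ x y : E, c * x * c * (c * y * c) = c * (x * y) * c := by
      intro x y
      calc c * x * c * (c * y * c) = c * x * (c * c) * y * c := by simp only [mul_assoc]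
        _ = _ := by rw [hc]; simp only [mul_assoc, one_mul]
    rw [commute_iff_eq, e, e, hxy.eq]
  have e1 : c1 * a * c1 = a := by rw [ha.eq, mul_assoc, h1, mul_one]
  have k1 := conj c1 _ _ h1 hab
  rw [e1] at k1
  have k2 := conj c2 _ _ h2 k1
  have e2 : c2 * (c1 * (c2 * a * c2) * c1) * c2 = c1 * (c2 * a * c2) * c1 := by
    calc c2 * (c1 * (c2 * a * c2) * c1) * c2 = (c2 * c1 * c2) * a * (c2 * c1 * c2) := by
          simp only [mul_assoc]
      _ = c1 * c2 * (c1 * a * c1) * c2 * c1 := by rw [← hb]; simp only [mul_assoc]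
      _ = _ := by rw [e1]; simp only [mul_assoc]
  rwa [e2] at k2

theorem conj_pow' {E : Type*} [Monoid E] {c a : E} (h : c * c = 1) (n : ℕ) :
    (c * a * c) ^ n = c * a ^ n * c := by
  induction n with
  | zero => simp [h]
  | succ n ih => 
    rw [pow_succ, ih, pow_succ]
    calc c * a ^ n * c * (c * a * c) = c * a ^ n * (c * c) * a * c := by simp only [mul_assoc]
      _ = _ := by rw [h]; simp only [mul_assoc, one_mul]

theorem proj_aux {K E : Type*} [Field K] [CharZero K] [Ring E] [Algebra K E] {T Q : E} {d : ℕ} (hd : 0 < d)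
    (hQ : IsIdempotentElem Q) (hc : Commute T Q) (hT : T ^ d * Q = Q) :
    IsIdempotentElem (((d : K)⁻¹ • ∑ i ∈ Finset.range d, T ^ i) * Q) := by
  set p := (d : K)⁻¹ • ∑ i ∈ Finset.range d, T ^ i with hp
  have h1 : T * (p * Q) = p * Q := by
    have : T * (∑ i ∈ Finset.range d, T ^ i) * Q = (∑ i ∈ Finset.range d, T ^ i) * Q := by
      have h2 := Finset.sum_range_succ' (fun i => T ^ i * Q) d
      rw [Finset.sum_range_succ] at h2
      rw [hT, pow_zero, one_mul] at h2
      have h3 := add_right_cancel h2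
      rw [Finset.sum_mul, h3, Finset.mul_sum, Finset.sum_mul]
      simp only [pow_succ']
    rw [hp, smul_mul_assoc, mul_smul_comm, ← mul_assoc, this]
  have h2 : ∀ i, T ^ i * (p * Q) = p * Q := by
    intro i
    induction i with
    | zero => simp
    | succ n ih => rw [pow_succ, mul_assoc, h1, ih]
  have h3 : p * (p * Q) = p * Q := by
    conv_lhs => rw [hp]
    rw [smul_mul_assoc, Finset.sum_mul, Finset.sum_congr rfl (fun i _ => h2 i)]
    simp only [Finset.sum_const, Finset.card_range]
    rw [← Nat.cast_smul_eq_nsmul K, smul_smul, inv_mul_cancel₀ (by exact_mod_cast hd.ne'), one_smul]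
  have hcp : Commute p Q := by
    rw [hp]
    apply Commute.smul_left
    exact Commute.sum_left _ _ _ fun i _ => hc.pow_left i
  unfold IsIdempotentElem at *
  calc p * Q * (p * Q) = p * (Q * p) * Q := by simp only [mul_assoc]
    _ = p * (p * (Q * Q)) := by rw [← hcp.eq]; simp only [mul_assoc]
    _ = _ := by rw [hQ, h3]

variable {K : Type*} {A : Type v} [Field K] [CharZero K] [Ring A] [Algebra K A] [FiniteDimensional K A]

theorem trace_idem_nat {Y : Type*} [AddCommGroup Y] [Module K Y] [FiniteDimensional K Y]
    {q : Module.End K Y} (hq : IsIdempotentElem q) : ∃ r : ℕ, LinearMap.trace K Y q = r :=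
  ⟨_, (LinearMap.IsIdempotentElem.isProj_range q hq).trace⟩

theorem lemM (R : A ⊗[K] A) (h4 : TensorProduct.comm K A A R * R = 1)
    (hy : i12 K A R * i13 K A R * i23 K A R = i23 K A R * i13 K A R * i12 K A R)
    (hk : kop K A R (TensorProduct.comm K A A R) = 1) {d : ℕ} (hd : 0 < d) (m : ℕ) :
    ∀ (Y : Type v) [AddCommGroup Y] [Module K Y] [FiniteDimensional K Y]
      (T : Module.End K (A ⊗[K] Y)) (q : Module.End K Y), IsIdempotentElem q →
      Commute (T.lTensor A : Module.End K (A ⊗[K] (A ⊗[K] Y))) (cc Y R * T.lTensor A * cc Y R) →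
      Commute T (q.lTensor A) → T ^ d * q.lTensor A = q.lTensor A →
      (∀ i, 0 < i → i < d → ptr K A Y (T ^ i) * q = 0) →
      ∃ r : ℕ, (r : K) * (d : K) ^ m = (Module.finrank K A : K) ^ m * LinearMap.trace K Y q := by
  have hd0 : (d : K) ≠ 0 := by exact_mod_cast hd.ne'
  induction m with
  | zero =>
    intro Y _ _ _ T q hq _ _ _ _
    obtain ⟨r, hr⟩ := trace_idem_nat hq
    exact ⟨r, by simp [hr]⟩
  | succ m ih =>
    intro Y _ _ _ T q hq t2 hTq hTd hptr
    set c := cc Y R with hc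
    set Q : Module.End K (A ⊗[K] Y) := q.lTensor A with hQ
    set p : Module.End K (A ⊗[K] Y) := (d : K)⁻¹ • ∑ i ∈ Finset.range d, T ^ i with hp
    have hcc : c * c = 1 := cc_cc Y R h4
    have hQi : IsIdempotentElem Q := by
      unfold IsIdempotentElem at *
      rw [hQ, ← LinearMap.lTensor_mul, hq]
    have hTp : Commute T p := by
      rw [hp]
      exact Commute.smul_right (Commute.sum_right _ _ _ fun i _ => (Commute.refl T).pow_right i) _
    have hpQ : Commute p Q := by
      rw [hp]
      exact Commute.smul_left (Commute.sum_left _ _ _ fun i _ => hTq.pow_left i) _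
    have lTp : ∀ n, (T ^ n).lTensor A = (T.lTensor A : Module.End K (A ⊗[K] (A ⊗[K] Y))) ^ n :=
      fun n => (LinearMap.lTensor_pow _ _).symm
    have hPi : IsIdempotentElem (p * Q) :=
      proj_aux (K := K) (E := Module.End K (A ⊗[K] Y)) hd hQi hTq hTd
    have main := ih (A ⊗[K] Y) (c * T.lTensor A * c) (p * Q) hPi ?_ ?_ ?_ ?_
    obtain ⟨r, hr⟩ := main
    · refine ⟨r, ?_⟩
      have ht : LinearMap.trace K _ (p * Q) = (d : K)⁻¹ * (Module.finrank K A * LinearMap.trace K Y q) := by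
        rw [← trace_ptr, hQ, ptr_mul_lT, hp, map_smul, map_sum, smul_mul_assoc, Finset.sum_mul, map_smul,
          smul_eq_mul]
        congr 1
        rw [Finset.sum_eq_single_of_mem 0 (Finset.mem_range.2 hd)]
        · rw [pow_zero, ptr_one]; simp
        · intro i hi hi0
          exact hptr i (Nat.pos_of_ne_zero hi0) (Finset.mem_range.1 hi)
      rw [ht] at hr
      rw [pow_succ, ← mul_assoc, hr, pow_succ]
      field_simp
    · have := t2_step (E := Module.End K (A ⊗[K] (A ⊗[K] (A ⊗[K] Y)))) (c1 := cc (A ⊗[K] Y) R)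
        (c2 := c.lTensor A) (a := (T.lTensor A).lTensor A)
        (cc_cc _ R h4) (by rw [← LinearMap.lTensor_mul, hcc, Module.End.one_eq_id, LinearMap.lTensor_id]; rfl)
        (cc_braid Y R hy) (cc_lT _ R _) (by
          have := congrArg (fun x => LinearMap.lTensor A x) t2.eq
          simp only [LinearMap.lTensor_mul] at this
          exact this)
      simpa only [LinearMap.lTensor_mul] using this
    · have hcQ : Commute c (LinearMap.lTensor A Q) := cc_lT Y R q
      have hTQ : Commute (LinearMap.lTensor A T) (LinearMap.lTensor A Q) := by
        rw [commute_iff_eq, ← LinearMap.lTensor_mul, hTq.eq, LinearMap.lTensor_mul]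
      have e1 : Commute (c * T.lTensor A * c) (LinearMap.lTensor A Q) :=
        (hcQ.mul_left hTQ).mul_left hcQ
      have e2 : Commute (c * T.lTensor A * c) (LinearMap.lTensor A p) := by
        rw [hp, LinearMap.lTensor_smul]
        have : LinearMap.lTensor A (∑ i ∈ Finset.range d, T ^ i) = ∑ i ∈ Finset.range d, (T.lTensor A : Module.End K (A ⊗[K] (A ⊗[K] Y))) ^ i := by
          have := map_sum (LinearMap.lTensorHom A : Module.End K (A ⊗[K] Y) →ₗ[K] _) (fun i => T ^ i) (Finset.range d)
          simp only [LinearMap.coe_lTensorHom, lTp] at this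
          exact this
        rw [this]
        exact Commute.smul_right (Commute.sum_right _ _ _ fun i _ => t2.symm.pow_right i) _
      rw [LinearMap.lTensor_mul]
      exact e2.mul_right e1
    · have hcQ : Commute c (LinearMap.lTensor A Q) := cc_lT Y R q
      rw [hpQ.eq, LinearMap.lTensor_mul, conj_pow' hcc, ← lTp]
      calc c * LinearMap.lTensor A (T ^ d) * c * (LinearMap.lTensor A Q * LinearMap.lTensor A p)
          = c * LinearMap.lTensor A (T ^ d) * (c * LinearMap.lTensor A Q) * LinearMap.lTensor A p := by
            simp only [mul_assoc]
        _ = c * (LinearMap.lTensor A (T ^ d) * LinearMap.lTensor A Q) * c * LinearMap.lTensor A p := by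
            rw [hcQ.eq]; simp only [mul_assoc]
        _ = (c * LinearMap.lTensor A Q) * c * LinearMap.lTensor A p := by
            rw [← LinearMap.lTensor_mul, hTd]
        _ = _ := by rw [hcQ.eq, mul_assoc _ c c, hcc, mul_one]
    · intro i hi hid
      rw [conj_pow' hcc, ← lTp, ptr_cc Y R hk, hpQ.eq, ← mul_assoc, hQ, ← LinearMap.lTensor_mul,
        hptr i hi hid, LinearMap.lTensor_zero, zero_mul]

theorem lemM_dvd (R : A ⊗[K] A) (h4 : TensorProduct.comm K A A R * R = 1)
    (hy : i12 K A R * i13 K A R * i23 K A R = i23 K A R * i13 K A R * i12 K A R)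
    (hk : kop K A R (TensorProduct.comm K A A R) = 1) {d : ℕ} (hd : 0 < d)
    (Y : Type v) [AddCommGroup Y] [Module K Y] [FiniteDimensional K Y]
      (T : Module.End K (A ⊗[K] Y)) (q : Module.End K Y) (hq : IsIdempotentElem q) (hq0 : q ≠ 0)
      (t2 : Commute (T.lTensor A : Module.End K (A ⊗[K] (A ⊗[K] Y))) (cc Y R * T.lTensor A * cc Y R))
      (h1 : Commute T (q.lTensor A)) (h2 : T ^ d * q.lTensor A = q.lTensor A)
      (h3 : ∀ i, 0 < i → i < d → ptr K A Y (T ^ i) * q = 0) : d ∣ Module.finrank K A := by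
  obtain ⟨t, ht⟩ := trace_idem_nat hq
  have ht0 : t ≠ 0 := by
    rintro rfl
    exact hq0 ((LinearMap.IsIdempotentElem.trace_eq_zero_iff hq).1 (by simpa using ht))
  refine nat_dvd_of_pow ht0 hd.ne' fun m => ?_
  obtain ⟨r, hr⟩ := lemM R h4 hy hk hd m Y T q hq t2 h1 h2 h3
  refine ⟨r, ?_⟩
  rw [ht] at hr
  exact_mod_cast hr
end lemM3

section base
universe v
variable {K : Type*} {A : Type v} [Field K] [Ring A] [HopfAlgebra K A]

def GG (K A : Type*) [Field K] [Ring A] [HopfAlgebra K A] : Module.End K (A ⊗[K] A) :=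
  TensorProduct.lift (((LinearMap.mul K (A ⊗[K] A)).compl₁₂
    ((TensorProduct.comm K A A).toLinearMap ∘ₗ Coalgebra.comul (R := K))
      ((TensorProduct.mk K A A).flip 1)).flip)

theorem GG_tmul (v x : A) : GG K A (v ⊗ₜ x) =
    TensorProduct.comm K A A (Coalgebra.comul (R := K) x) * (v ⊗ₜ 1) := by
  simp [GG]

theorem comm_mul' (x y : A ⊗[K] A) : TensorProduct.comm K A A (x * y) =
    TensorProduct.comm K A A x * TensorProduct.comm K A A y :=
  map_mul (Algebra.TensorProduct.comm K A A) x y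

theorem comm_one' : TensorProduct.comm K A A 1 = 1 :=
  map_one (Algebra.TensorProduct.comm K A A)

def ml (x : A ⊗[K] (A ⊗[K] A)) : Module.End K (A ⊗[K] (A ⊗[K] A)) := LinearMap.mulLeft K x

theorem ml_mul (x y : A ⊗[K] (A ⊗[K] A)) : ml (x * y) = ml x * ml y := by
  rw [ml, LinearMap.mulLeft_mul]; rfl
theorem ml_add (x y : A ⊗[K] (A ⊗[K] A)) : ml (x + y) = ml x + ml y := by
  refine LinearMap.ext fun z => ?_; exact add_mul x y z
theorem ml_zero : ml (0 : A ⊗[K] (A ⊗[K] A)) = 0 := by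
  refine LinearMap.ext fun z => ?_; exact zero_mul z
theorem ml_one : ml (1 : A ⊗[K] (A ⊗[K] A)) = 1 := by
  refine LinearMap.ext fun z => ?_; exact one_mul z

theorem ml_apply (x y : A ⊗[K] (A ⊗[K] A)) : ml x y = x * y := rfl

theorem rho2_ml (x : A ⊗[K] A) : rho2 K A A x = ml (i12 K A x) := by
  induction x using TensorProduct.induction_on with
  | zero => simp [ml_zero]
  | add x y hx hy => simp only [map_add, hx, hy, ml_add]
  | tmul a b => 
    rw [rho2_tmul, i12, LinearMap.lTensor_tmul]
    ext; simp [ml_apply]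

theorem lT_ml (x : A ⊗[K] A) : LinearMap.lTensor A (LinearMap.mulLeft K x) = ml (i23 K A x) := by
  ext; simp [ml_apply, i23]

theorem i12_mul (x y : A ⊗[K] A) : i12 K A (x * y) = i12 K A x * i12 K A y :=
  map_mul (Algebra.TensorProduct.map (AlgHom.id K A) (Algebra.TensorProduct.includeLeft (R := K) (S := K) (A := A) (B := A))) x y
theorem i13_mul (x y : A ⊗[K] A) : i13 K A (x * y) = i13 K A x * i13 K A y :=
  map_mul (Algebra.TensorProduct.map (AlgHom.id K A) (Algebra.TensorProduct.includeRight (R := K) (A := A) (B := A))) x y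
theorem i23_mul (x y : A ⊗[K] A) : i23 K A (x * y) = i23 K A x * i23 K A y :=
  map_mul (Algebra.TensorProduct.includeRight (R := K) (A := A) (B := A ⊗[K] A)) x y
theorem i12_one : i12 K A 1 = 1 := by
  simp [i12, Algebra.TensorProduct.one_def]
theorem i13_one : i13 K A 1 = 1 := by
  simp [i13, Algebra.TensorProduct.one_def]
theorem i23_one : i23 K A 1 = 1 := by
  simp [i23, Algebra.TensorProduct.one_def]

theorem sg_ml13 (x : A ⊗[K] A) : sg K A A * ml (i13 K A x) = ml (i23 K A x) * sg K A A := by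
  induction x using TensorProduct.induction_on with
  | zero => simp [ml_zero]
  | add x y hx hy => simp only [map_add, ml_add, mul_add, add_mul, hx, hy]
  | tmul a b =>
    ext; simp [ml_apply, i13, i23, sg]

theorem sg_ml23 (x : A ⊗[K] A) : sg K A A * ml (i23 K A x) = ml (i13 K A x) * sg K A A := by
  induction x using TensorProduct.induction_on with
  | zero => simp [ml_zero]
  | add x y hx hy => simp only [map_add, ml_add, mul_add, add_mul, hx, hy]
  | tmul a b =>
    ext; simp [ml_apply, i13, i23, sg]

theorem sg_ml12 (x : A ⊗[K] A) : sg K A A * ml (i12 K A x) =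
    ml (i12 K A (TensorProduct.comm K A A x)) * sg K A A := by
  rw [← rho2_ml, sg_rho2, rho2_ml]

/-- `a ⊗ b ↦ a ⊗ Δᵒᵖ b`. -/
theorem G23_ml13 (x : A ⊗[K] A) : LinearMap.lTensor A (GG K A) * ml (i13 K A x) =
    ml (LinearMap.lTensor A ((TensorProduct.comm K A A).toLinearMap ∘ₗ Coalgebra.comul (R := K)) x) *
      LinearMap.lTensor A (GG K A) := by
  induction x using TensorProduct.induction_on with
  | zero => simp [ml_zero]
  | add x y hx hy => simp only [map_add, ml_add, mul_add, add_mul, hx, hy]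
  | tmul a b =>
    ext h v x
    simp [ml_apply, i13, GG_tmul, Bialgebra.comul_mul, comm_mul', mul_assoc]

def DD (z : A ⊗[K] A) : A ⊗[K] A →ₗ[K] A ⊗[K] (A ⊗[K] A) :=
  (TensorProduct.assoc K A A A).toLinearMap ∘ₗ
    (TensorProduct.map (LinearMap.mulRight K z ∘ₗ Coalgebra.comul (R := K)) LinearMap.id) ∘ₗ
    (TensorProduct.comm K A A).toLinearMap

theorem DD_tmul (z : A ⊗[K] A) (p q : A) : DD z (p ⊗ₜ q) =
    TensorProduct.assoc K A A A ((Coalgebra.comul (R := K) q * z) ⊗ₜ p) := by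
  simp [DD]

theorem DD_add (z w : A ⊗[K] A) : DD (z + w) = DD z + DD w := by
  ext p q; simp [DD_tmul, mul_add, add_tmul]

def DDop (z : A ⊗[K] A) : A ⊗[K] A →ₗ[K] A ⊗[K] (A ⊗[K] A) :=
  (TensorProduct.assoc K A A A).toLinearMap ∘ₗ
    (TensorProduct.map (LinearMap.mulRight K z ∘ₗ (TensorProduct.comm K A A).toLinearMap ∘ₗ Coalgebra.comul (R := K)) LinearMap.id) ∘ₗ
    (TensorProduct.comm K A A).toLinearMap

theorem DDop_tmul (z : A ⊗[K] A) (p q : A) : DDop z (p ⊗ₜ q) =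
    TensorProduct.assoc K A A A ((TensorProduct.comm K A A (Coalgebra.comul (R := K) q) * z) ⊗ₜ p) := by
  simp [DDop]

theorem DDop_add (z w : A ⊗[K] A) : DDop (z + w) = DDop z + DDop w := by
  ext p q; simp [DDop_tmul, mul_add, add_tmul]

theorem sg_assoc (w : A ⊗[K] A) (p : A) : sg K A A (TensorProduct.assoc K A A A (w ⊗ₜ p)) =
    TensorProduct.assoc K A A A (TensorProduct.comm K A A w ⊗ₜ p) := by
  induction w using TensorProduct.induction_on with
  | zero => simp
  | add x y hx hy => simp only [map_add, add_tmul, hx, hy]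
  | tmul a b => simp [sg]

theorem sg_DD (z : A ⊗[K] A) (t : A ⊗[K] A) : sg K A A (DD z t) = DDop (TensorProduct.comm K A A z) t := by
  induction t using TensorProduct.induction_on with
  | zero => simp
  | add x y hx hy => simp only [map_add, hx, hy]
  | tmul a b => rw [DD_tmul, DDop_tmul, sg_assoc, comm_mul']

theorem G13G23_apply0 (h v x : A) :
    (sg K A A * LinearMap.lTensor A (GG K A) * sg K A A * LinearMap.lTensor A (GG K A)) (h ⊗ₜ (v ⊗ₜ x)) =
    DD (h ⊗ₜ v) (Coalgebra.comul (R := K) x) := by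
  -- F' ((p ⊗ q) ⊗ r) = q h ⊗ (r v ⊗ p)
  let F : A ⊗[K] (A ⊗[K] A) →ₗ[K] A ⊗[K] (A ⊗[K] A) :=
    (TensorProduct.assoc K A A A).toLinearMap ∘ₗ (TensorProduct.comm K A (A ⊗[K] A)).toLinearMap ∘ₗ
      (TensorProduct.map LinearMap.id (LinearMap.mulRight K (h ⊗ₜ[K] v)))
  have e1 : ∀ t : A ⊗[K] A, DD (h ⊗ₜ v) t = F (LinearMap.lTensor A (Coalgebra.comul (R := K)) t) := by
    intro t
    induction t using TensorProduct.induction_on with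
    | zero => simp
    | add x y hx hy => simp only [map_add, hx, hy]
    | tmul a b => rw [DD_tmul]; simp [F]
  have e3 : ∀ (s : A ⊗[K] A) (q : A), sg K A A ((q * v) ⊗ₜ (TensorProduct.comm K A A s * (h ⊗ₜ 1))) =
      F (TensorProduct.assoc K A A A (s ⊗ₜ q)) := by
    intro t q
    induction t using TensorProduct.induction_on with
    | zero => simp
    | add x y hx hy => simp only [map_add, add_mul, tmul_add, add_tmul, hx, hy]
    | tmul a b => simp [F, sg]
  have e2 : ∀ t : A ⊗[K] A, sg K A A (LinearMap.lTensor A (GG K A) (sg K A A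
      (h ⊗ₜ (TensorProduct.comm K A A t * (v ⊗ₜ 1))))) =
      F (TensorProduct.assoc K A A A (LinearMap.rTensor A (Coalgebra.comul (R := K)) t)) := by
    intro t
    induction t using TensorProduct.induction_on with
    | zero => simp
    | add x y hx hy => simp only [map_add, add_mul, tmul_add, hx, hy]
    | tmul a b =>
      rw [LinearMap.rTensor_tmul, ← e3]
      simp [sg, GG_tmul]
  simp only [Module.End.mul_apply, LinearMap.lTensor_tmul, GG_tmul]
  rw [e2, e1, Coalgebra.coassoc_apply]

theorem G13G23_apply (z : A ⊗[K] A) (x : A) :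
    (sg K A A * LinearMap.lTensor A (GG K A) * sg K A A * LinearMap.lTensor A (GG K A))
      (TensorProduct.assoc K A A A (z ⊗ₜ x)) = DD z (Coalgebra.comul (R := K) x) := by
  induction z using TensorProduct.induction_on with
  | zero => simp [DD]
  | add x y hx hy => rw [add_tmul, map_add, map_add, hx, hy, DD_add]; rfl
  | tmul a b => rw [TensorProduct.assoc_tmul, G13G23_apply0]

theorem G23G13_apply (z : A ⊗[K] A) (x : A) :
    (LinearMap.lTensor A (GG K A) * (sg K A A * LinearMap.lTensor A (GG K A) * sg K A A))
      (TensorProduct.assoc K A A A (z ⊗ₜ x)) = DDop z (Coalgebra.comul (R := K) x) := by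
  have h1 : (LinearMap.lTensor A (GG K A) * (sg K A A * LinearMap.lTensor A (GG K A) * sg K A A)) =
    sg K A A * ((sg K A A * LinearMap.lTensor A (GG K A) * sg K A A * LinearMap.lTensor A (GG K A))) * sg K A A := by
    simp only [← mul_assoc]
    rw [sg_sg, one_mul]
  rw [h1, Module.End.mul_apply, Module.End.mul_apply, sg_assoc, G13G23_apply, sg_DD]
  congr 1
  simp

theorem ml12_assoc (R w : A ⊗[K] A) (p : A) : ml (i12 K A R) (TensorProduct.assoc K A A A (w ⊗ₜ p)) =
    TensorProduct.assoc K A A A ((R * w) ⊗ₜ p) := by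
  induction R using TensorProduct.induction_on with
  | zero => simp [ml_zero]
  | add x y hx hy => simp only [map_add, ml_add, LinearMap.add_apply, add_mul, add_tmul, hx, hy]
  | tmul a b =>
    induction w using TensorProduct.induction_on with
    | zero => simp
    | add x y hx hy => simp only [map_add, mul_add, add_tmul, hx, hy]
    | tmul c d => simp [ml_apply, i12]

theorem ext_assoc {f g : Module.End K (A ⊗[K] (A ⊗[K] A))}
    (h : ∀ z x, f (TensorProduct.assoc K A A A (z ⊗ₜ x)) = g (TensorProduct.assoc K A A A (z ⊗ₜ x))) : f = g := by
  ext a b c; exact h (a ⊗ₜ b) c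

theorem g3 (R : A ⊗[K] A) (hR3 : ∀ x : A, R * Coalgebra.comul (R := K) x
      = TensorProduct.comm K A A (Coalgebra.comul (R := K) x) * R) :
    ml (i12 K A R) * (sg K A A * LinearMap.lTensor A (GG K A) * sg K A A * LinearMap.lTensor A (GG K A)) =
    LinearMap.lTensor A (GG K A) * (sg K A A * LinearMap.lTensor A (GG K A) * sg K A A) * ml (i12 K A R) := by
  apply ext_assoc
  intro z x
  rw [Module.End.mul_apply, G13G23_apply, Module.End.mul_apply, ml12_assoc, G23G13_apply]
  generalize Coalgebra.comul (R := K) x = t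
  induction t using TensorProduct.induction_on with
  | zero => simp
  | add x y hx hy => simp only [map_add, hx, hy]
  | tmul a b => rw [DD_tmul, DDop_tmul, ml12_assoc, ← mul_assoc, hR3, mul_assoc]

def Th0 (K A : Type*) [Field K] [Ring A] [HopfAlgebra K A] : Module.End K (A ⊗[K] A) :=
  TensorProduct.lift ((LinearMap.mul K (A ⊗[K] A)).compl₁₂
    (Coalgebra.comul (R := K)) (TensorProduct.mk K A A 1))

theorem Th0_tmul (y v : A) : Th0 K A (y ⊗ₜ v) = Coalgebra.comul (R := K) y * (1 ⊗ₜ v) := by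
  simp [Th0]

def Ti0 (K A : Type*) [Field K] [Ring A] [HopfAlgebra K A] : Module.End K (A ⊗[K] A) :=
  TensorProduct.lift ((LinearMap.mul K (A ⊗[K] A)).compl₁₂
    (LinearMap.lTensor A (HopfAlgebra.antipode K) ∘ₗ Coalgebra.comul (R := K)) (TensorProduct.mk K A A 1))

theorem Ti0_tmul (y v : A) : Ti0 K A (y ⊗ₜ v) =
    LinearMap.lTensor A (HopfAlgebra.antipode K) (Coalgebra.comul (R := K) y) * (1 ⊗ₜ v) := by
  simp [Ti0]

theorem Th0_Ti0 : Th0 K A * Ti0 K A = 1 := by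
  refine TensorProduct.ext' fun y v => ?_
  rw [Module.End.mul_apply, Ti0_tmul, Module.End.one_apply]
  -- F (p ⊗ (q ⊗ r)) = p ⊗ q S(r) v
  let F : A ⊗[K] (A ⊗[K] A) →ₗ[K] A ⊗[K] A :=
    LinearMap.lTensor A (LinearMap.mulRight K v ∘ₗ LinearMap.mul' K A ∘ₗ LinearMap.lTensor A (HopfAlgebra.antipode K))
  have e3 : ∀ (s : A ⊗[K] A) (q : A), s * (1 ⊗ₜ (HopfAlgebra.antipode K q * v)) = F (TensorProduct.assoc K A A A (s ⊗ₜ q)) := by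
    intro s q
    induction s using TensorProduct.induction_on with
    | zero => simp
    | add x y hx hy => simp only [map_add, add_mul, add_tmul, hx, hy]
    | tmul a b => simp [F, mul_assoc]
  have e2 : ∀ t : A ⊗[K] A, Th0 K A (LinearMap.lTensor A (HopfAlgebra.antipode K) t * 1 ⊗ₜ[K] v) =
      F (TensorProduct.assoc K A A A (LinearMap.rTensor A (Coalgebra.comul (R := K)) t)) := by
    intro t
    induction t using TensorProduct.induction_on with
    | zero => simp
    | add x y hx hy => simp only [map_add, add_mul, hx, hy]
    | tmul a b => rw [LinearMap.rTensor_tmul, ← e3]; simp [Th0_tmul]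
  have e4 : ∀ t : A ⊗[K] A, F (LinearMap.lTensor A (Coalgebra.comul (R := K)) t) =
      LinearMap.lTensor A (LinearMap.mulRight K v ∘ₗ Algebra.linearMap K A ∘ₗ Coalgebra.counit (R := K)) t := by
    intro t
    induction t using TensorProduct.induction_on with
    | zero => simp
    | add x y hx hy => simp only [map_add, hx, hy]
    | tmul a b =>
      have := HopfAlgebra.mul_antipode_lTensor_comul_apply (R := K) b
      simp [F, this]
  rw [e2, Coalgebra.coassoc_apply, e4, LinearMap.lTensor_comp, LinearMap.lTensor_comp,
    LinearMap.comp_apply, LinearMap.comp_apply, Coalgebra.lTensor_counit_comul]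
  simp

end base

section base5
universe v

theorem t23_aux {E : Type*} [Monoid E] {s g r12 i12 r13 i13 r23 i23 : E}
    (hs : s * s = 1) (h12 : r12 * i12 = 1) (h12' : i12 * r12 = 1) (h13 : r13 * i13 = 1)
    (h13' : i13 * r13 = 1) (h23 : r23 * i23 = 1) (h23' : i23 * r23 = 1)
    (s13 : s * r13 = r23 * s) (s23 : s * r23 = r13 * s) (s23' : s * i23 = i13 * s)
    (s12 : s * r12 = i12 * s)
    (g1 : g * r13 = r12 * r13 * g) (g3 : r12 * (s * g * s * g) = g * (s * g * s) * r12)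
    (ybe : r12 * r13 * r23 = r23 * r13 * r12) :
    Commute (i23 * g * r23) (s * r12 * (i23 * g * r23) * (s * r12)) ∧
    ∀ th : E, th * r13 = r13 * r23 * th → th * (s * g * s) = s * g * s * g * th →
      th * (s * (i23 * g * r23) * s) =
        (i23 * g * r23) * (s * r12 * (i23 * g * r23) * (s * r12)) * th := by
  set G := s * g * s with hG
  set O := r12 * r13 * r23 with hO
  have hOu : IsUnit O := by
    refine IsUnit.mul (IsUnit.mul ?_ ?_) ?_
    · exact ⟨⟨r12, i12, h12, h12'⟩, rfl⟩
    · exact ⟨⟨r13, i13, h13, h13'⟩, rfl⟩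
    · exact ⟨⟨r23, i23, h23, h23'⟩, rfl⟩
  have g2 : G * r23 = i12 * r23 * G := by
    calc G * r23 = s * g * (s * r23) := by rw [hG]; simp only [mul_assoc]
      _ = s * (g * r13) * s := by rw [s23]; simp only [mul_assoc]
      _ = (s * r12) * r13 * g * s := by rw [g1]; simp only [mul_assoc]
      _ = i12 * (s * r13) * g * s := by rw [s12]; simp only [mul_assoc]
      _ = _ := by rw [s13, hG]; simp only [mul_assoc]
  have ct : s * r12 * (i23 * g * r23) * (s * r12) = i12 * i13 * G * r13 * r12 := by
    calc s * r12 * (i23 * g * r23) * (s * r12) = (s * r12) * i23 * g * r23 * s * r12 := by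
          simp only [mul_assoc]
      _ = i12 * (s * i23) * g * r23 * s * r12 := by rw [s12]; simp only [mul_assoc]
      _ = i12 * i13 * s * g * (r23 * s) * r12 := by rw [s23']; simp only [mul_assoc]
      _ = _ := by rw [← s13, hG]; simp only [mul_assoc]
  have k1 : O * (i23 * g * r23) = g * i12 * O := by
    calc O * (i23 * g * r23) = r12 * r13 * (r23 * i23) * g * r23 := by rw [hO]; simp only [mul_assoc]
      _ = (r12 * r13 * g) * r23 := by rw [h23, mul_one]
      _ = g * (i12 * r12) * r13 * r23 := by rw [← g1, h12', mul_one]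
      _ = _ := by rw [hO]; simp only [mul_assoc]
  have k2 : O * (i12 * i13 * G * r13 * r12) = r12 * G * O := by
    calc O * (i12 * i13 * G * r13 * r12) = r23 * r13 * (r12 * i12) * i13 * G * r13 * r12 := by
          rw [ybe]; simp only [mul_assoc]
      _ = r23 * (r13 * i13) * G * r13 * r12 := by rw [h12, mul_one]; simp only [mul_assoc]
      _ = (r12 * i12) * r23 * G * r13 * r12 := by rw [h13, h12]; simp only [mul_assoc, one_mul]
      _ = r12 * (i12 * r23 * G) * r13 * r12 := by simp only [mul_assoc]
      _ = _ := by rw [← g2, ybe]; simp only [mul_assoc]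
  rw [ct]
  set t := i23 * g * r23
  set t' := i12 * i13 * G * r13 * r12
  have m1 : O * (t * t') = g * G * O := by
    rw [← mul_assoc, k1, mul_assoc, k2]
    calc g * i12 * (r12 * G * O) = g * (i12 * r12) * G * O := by simp only [mul_assoc]
      _ = _ := by rw [h12', mul_one]
  have m2 : O * (t' * t) = g * G * O := by
    rw [← mul_assoc, k2, mul_assoc, k1]
    calc r12 * G * (g * i12 * O) = (r12 * (G * g)) * i12 * O := by simp only [mul_assoc]
      _ = g * G * (r12 * i12) * O := by rw [g3]; simp only [mul_assoc]
      _ = _ := by rw [h12, mul_one]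
  refine ⟨hOu.mul_left_cancel (m1.trans m2.symm), fun th h1 h2 => ?_⟩
  apply hOu.mul_left_cancel
  rw [← mul_assoc O (t * t'), m1]
  have e : s * t * s = i13 * G * r13 := by
    calc s * t * s = (s * i23) * g * (r23 * s) := by simp only [t, mul_assoc]
      _ = _ := by rw [s23', ← s13, hG]; simp only [mul_assoc]
  rw [e]
  calc O * (th * (i13 * G * r13)) = r12 * (r13 * r23 * th) * i13 * G * r13 := by
        simp only [hO, mul_assoc]
    _ = r12 * th * (r13 * i13) * G * r13 := by rw [← h1]; simp only [mul_assoc]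
    _ = r12 * (th * G) * r13 := by rw [h13, mul_one]; simp only [mul_assoc]
    _ = (r12 * (G * g)) * (th * r13) := by rw [h2]; simp only [mul_assoc]
    _ = _ := by rw [g3, h1, hO]; simp only [mul_assoc]

variable {K : Type*} {A : Type v} [Field K] [Ring A] [HopfAlgebra K A]

def Th12 (f : Module.End K (A ⊗[K] A)) : Module.End K (A ⊗[K] (A ⊗[K] A)) :=
  (TensorProduct.assoc K A A A).toLinearMap ∘ₗ LinearMap.rTensor A f ∘ₗ
    (TensorProduct.assoc K A A A).symm.toLinearMap

theorem Th12_assoc (f : Module.End K (A ⊗[K] A)) (z x) :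
    Th12 f (TensorProduct.assoc K A A A (z ⊗ₜ x)) = TensorProduct.assoc K A A A (f z ⊗ₜ x) := by
  simp [Th12]

theorem Th12_mul (f g : Module.End K (A ⊗[K] A)) : Th12 (f * g) = Th12 f * Th12 g := by
  apply ext_assoc; intro z x
  simp only [Module.End.mul_apply, Th12_assoc]

theorem Th12_one : Th12 (1 : Module.End K (A ⊗[K] A)) = 1 := by
  apply ext_assoc; intro z x
  simp only [Module.End.one_apply, Th12_assoc]

theorem assoc_mul' (x y : (A ⊗[K] A) ⊗[K] A) : TensorProduct.assoc K A A A (x * y) =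
    TensorProduct.assoc K A A A x * TensorProduct.assoc K A A A y :=
  map_mul (Algebra.TensorProduct.assoc K K K A A A) x y

theorem Th_ml13 (x : A ⊗[K] A) : Th12 (Th0 K A) * ml (i13 K A x) =
    ml (TensorProduct.assoc K A A A (LinearMap.rTensor A (Coalgebra.comul (R := K)) x)) *
      Th12 (Th0 K A) := by
  induction x using TensorProduct.induction_on with
  | zero => simp [ml_zero]
  | add x y hx hy => simp only [map_add, ml_add, mul_add, add_mul, hx, hy]
  | tmul a b =>
    apply ext_assoc; intro z x
    rw [Module.End.mul_apply, Module.End.mul_apply, Th12_assoc, ml_apply, LinearMap.rTensor_tmul,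
      ml_apply, ← assoc_mul', Algebra.TensorProduct.tmul_mul_tmul]
    induction z using TensorProduct.induction_on with
    | zero => simp
    | add x y hx hy => simp only [map_add, mul_add, add_tmul, hx, hy]
    | tmul y v =>
      have : i13 K A (a ⊗ₜ[K] b) * (TensorProduct.assoc K A A A) ((y ⊗ₜ[K] v) ⊗ₜ[K] x) =
        TensorProduct.assoc K A A A (((a * y) ⊗ₜ[K] v) ⊗ₜ[K] (b * x)) := by
        simp [i13]
      rw [this, Th12_assoc, Th0_tmul, Th0_tmul, Bialgebra.comul_mul, mul_assoc]

theorem Th_G13 : Th12 (Th0 K A) * (sg K A A * LinearMap.lTensor A (GG K A) * sg K A A) =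
    sg K A A * LinearMap.lTensor A (GG K A) * sg K A A * LinearMap.lTensor A (GG K A) *
      Th12 (Th0 K A) := by
  apply ext_assoc; intro z x
  rw [Module.End.mul_apply, Module.End.mul_apply _ (Th12 (Th0 K A)), Th12_assoc, G13G23_apply]
  induction z using TensorProduct.induction_on with
  | zero => simp [DD]
  | add x y hx hy => simp only [map_add, add_tmul, DD_add, LinearMap.add_apply, hx, hy]
  | tmul y v =>
    have e : (sg K A A * LinearMap.lTensor A (GG K A) * sg K A A)
        (TensorProduct.assoc K A A A ((y ⊗ₜ v) ⊗ₜ x)) =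
        sg K A A (v ⊗ₜ (TensorProduct.comm K A A (Coalgebra.comul (R := K) x) * (y ⊗ₜ 1))) := by
      simp [sg, GG_tmul]
    rw [e, Th0_tmul]
    generalize Coalgebra.comul (R := K) x = t
    induction t using TensorProduct.induction_on with
    | zero => simp
    | add x y hx hy => simp only [map_add, add_mul, tmul_add, hx, hy]
    | tmul p q =>
      have e2 : sg K A A (v ⊗ₜ (TensorProduct.comm K A A (p ⊗ₜ q) * (y ⊗ₜ 1))) =
        TensorProduct.assoc K A A A (((q * y) ⊗ₜ v) ⊗ₜ p) := by simp [sg]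
      rw [e2, Th12_assoc, Th0_tmul, DD_tmul, Bialgebra.comul_mul, mul_assoc]

/-- the basic operator -/
def TT (R : A ⊗[K] A) : Module.End K (A ⊗[K] A) :=
  LinearMap.mulLeft K (TensorProduct.comm K A A R) * GG K A * LinearMap.mulLeft K R

theorem TT_T23 (R : A ⊗[K] A)
    (hr1 : TensorProduct.assoc K A A A (LinearMap.rTensor A (Coalgebra.comul (R := K)) R) =
      i13 K A R * i23 K A R)
    (hr2 : LinearMap.lTensor A ((TensorProduct.comm K A A).toLinearMap ∘ₗ Coalgebra.comul (R := K)) R =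
      i12 K A R * i13 K A R)
    (hR3 : ∀ x : A, R * Coalgebra.comul (R := K) x
      = TensorProduct.comm K A A (Coalgebra.comul (R := K) x) * R)
    (h4 : TensorProduct.comm K A A R * R = 1) (h4' : R * TensorProduct.comm K A A R = 1)
    (hy : i12 K A R * i13 K A R * i23 K A R = i23 K A R * i13 K A R * i12 K A R) :
    Commute ((TT R).lTensor A : Module.End K (A ⊗[K] (A ⊗[K] A)))
      (cc A R * (TT R).lTensor A * cc A R) ∧
    Th12 (Th0 K A) * (sg K A A * (TT R).lTensor A * sg K A A) =
      (TT R).lTensor A * (cc A R * (TT R).lTensor A * cc A R) * Th12 (Th0 K A) := by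
  have inv : ∀ x y : A ⊗[K] A, x * y = 1 →
    ml (i12 K A x) * ml (i12 K A y) = 1 ∧ ml (i13 K A x) * ml (i13 K A y) = 1 ∧
    ml (i23 K A x) * ml (i23 K A y) = 1 := by
    intro x y h
    refine ⟨?_, ?_, ?_⟩
    · rw [← ml_mul, ← i12_mul, h, i12_one, ml_one]
    · rw [← ml_mul, ← i13_mul, h, i13_one, ml_one]
    · rw [← ml_mul, ← i23_mul, h, i23_one, ml_one]
  have e : (TT R).lTensor A = ml (i23 K A (TensorProduct.comm K A A R)) *
      LinearMap.lTensor A (GG K A) * ml (i23 K A R) := by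
    rw [TT, LinearMap.lTensor_mul, LinearMap.lTensor_mul, lT_ml, lT_ml]
  rw [e, cc, rho2_ml]
  have := t23_aux (E := Module.End K (A ⊗[K] (A ⊗[K] A))) (s := sg K A A)
    (g := LinearMap.lTensor A (GG K A)) (sg_sg A)
    (inv _ _ h4').1 (inv _ _ h4).1 (inv _ _ h4').2.1 (inv _ _ h4).2.1 (inv _ _ h4').2.2
    (inv _ _ h4).2.2 (sg_ml13 R) (sg_ml23 R) (sg_ml23 _) (sg_ml12 R)
    (by rw [G23_ml13, hr2, ml_mul]) (g3 R hR3) (by rw [← ml_mul, ← ml_mul, hy, ml_mul, ml_mul])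
  exact ⟨this.1, this.2 _ (by rw [Th_ml13, hr1, ml_mul]) Th_G13⟩

end base5

section base6
universe v
variable {K : Type*} {A : Type v} [Field K] [Ring A] [HopfAlgebra K A] [FiniteDimensional K A]

theorem ptr_BF {Y : Type*} [AddCommGroup Y] [Module K Y] [FiniteDimensional K Y]
    (z : A) (F : A →ₗ[K] Module.End K Y) :
    ptr K A Y (TensorProduct.lift (LinearMap.compr₂ F (TensorProduct.mk K A Y z))) = F z := by
  let b := Module.finBasis K A
  have e : TensorProduct.lift (LinearMap.compr₂ F (TensorProduct.mk K A Y z)) =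
      ∑ i, TensorProduct.map ((b.coord i).smulRight z) (F (b i)) := by
    refine TensorProduct.ext' fun y w => ?_
    simp only [lift.tmul, LinearMap.sum_apply, map_tmul, LinearMap.smulRight_apply, smul_tmul,
      ← tmul_sum]
    have h1 : F y = ∑ i, b.coord i y • F (b i) := by
      simp only [← map_smul, ← map_sum, Module.Basis.coord_apply, b.sum_repr]
    rw [LinearMap.compr₂_apply, TensorProduct.mk_apply, h1]
    simp only [LinearMap.sum_apply, LinearMap.smul_apply, tmul_sum]
  rw [e, map_sum]
  simp only [ptr_map, LinearMap.trace_smulRight]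
  simp only [← map_smul, ← map_sum, Module.Basis.coord_apply, b.sum_repr]

theorem flipS (hS : ∀ x : A, HopfAlgebra.antipode K (HopfAlgebra.antipode K x) = x) (b : A) :
    LinearMap.mul' K A (TensorProduct.comm K A A (LinearMap.rTensor A (HopfAlgebra.antipode K)
      (Coalgebra.comul (R := K) b))) = algebraMap K A (Coalgebra.counit (R := K) b) := by
  have h1 := congrArg (HopfAlgebra.antipode K) (HopfAlgebra.mul_antipode_lTensor_comul_apply (R := K) b)
  have h2 : ∀ t : A ⊗[K] A, HopfAlgebra.antipode K (LinearMap.mul' K A (LinearMap.lTensor A (HopfAlgebra.antipode K) t)) =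
    LinearMap.mul' K A (TensorProduct.comm K A A (LinearMap.rTensor A (HopfAlgebra.antipode K) t)) := by
    intro t
    induction t using TensorProduct.induction_on with
    | zero => simp
    | add x y hx hy => simp only [map_add, hx, hy]
    | tmul p q => simp [HopfAlgebra.antipode_mul_antidistrib, hS]
  rw [← h2, h1]
  simp [Algebra.algebraMap_eq_smul_one]

theorem psi_lemma (hS : ∀ x : A, HopfAlgebra.antipode K (HopfAlgebra.antipode K x) = x)
    (φ : A →ₗ[K] K) (z : A) :
    LinearMap.mul' K A (TensorProduct.comm K A A (LinearMap.rTensor A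
      (HopfAlgebra.antipode K ∘ₗ (TensorProduct.lid K A).toLinearMap ∘ₗ
        LinearMap.rTensor A φ ∘ₗ Coalgebra.comul (R := K)) (Coalgebra.comul (R := K) z))) = φ z • (1 : A) := by
  let F : A ⊗[K] (A ⊗[K] A) →ₗ[K] A :=
    (TensorProduct.lid K A).toLinearMap ∘ₗ TensorProduct.map φ
      (LinearMap.mul' K A ∘ₗ (TensorProduct.comm K A A).toLinearMap ∘ₗ
        LinearMap.rTensor A (HopfAlgebra.antipode K))
  have e3 : ∀ (s : A ⊗[K] A) (q : A), q * HopfAlgebra.antipode K (TensorProduct.lid K A (LinearMap.rTensor A φ s)) =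
      F (TensorProduct.assoc K A A A (s ⊗ₜ q)) := by
    intro s q
    induction s using TensorProduct.induction_on with
    | zero => simp
    | add x y hx hy => simp only [map_add, mul_add, add_tmul, hx, hy]
    | tmul a b => simp [F]
  have e2 : ∀ t : A ⊗[K] A, LinearMap.mul' K A (TensorProduct.comm K A A (LinearMap.rTensor A
      (HopfAlgebra.antipode K ∘ₗ (TensorProduct.lid K A).toLinearMap ∘ₗ
        LinearMap.rTensor A φ ∘ₗ Coalgebra.comul (R := K)) t)) =
      F (TensorProduct.assoc K A A A (LinearMap.rTensor A (Coalgebra.comul (R := K)) t)) := by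
    intro t
    induction t using TensorProduct.induction_on with
    | zero => simp
    | add x y hx hy => simp only [map_add, hx, hy]
    | tmul a b =>
      rw [LinearMap.rTensor_tmul, LinearMap.rTensor_tmul, ← e3]; simp
  have e4 : ∀ t : A ⊗[K] A, F (LinearMap.lTensor A (Coalgebra.comul (R := K)) t) =
      TensorProduct.lid K A (TensorProduct.map φ (Algebra.linearMap K A) (LinearMap.lTensor A (Coalgebra.counit (R := K)) t)) := by
    intro t
    induction t using TensorProduct.induction_on with
    | zero => simp
    | add x y hx hy => simp only [map_add, hx, hy]
    | tmul a b =>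
      have := flipS hS b
      simp [F, this]
  rw [e2, Coalgebra.coassoc_apply, e4, Coalgebra.lTensor_counit_comul]
  simp

theorem ptr_theta (hS : ∀ x : A, HopfAlgebra.antipode K (HopfAlgebra.antipode K x) = x)
    (B : Module.End K (A ⊗[K] A)) :
    ptr K A (A ⊗[K] A) (Th12 (Th0 K A) * (sg K A A * B.lTensor A * sg K A A) * Th12 (Ti0 K A)) =
      (ptr K A A B).lTensor A := by
  induction B using end_induction with
  | h0 => simp
  | ha x y hx hy => simp only [LinearMap.lTensor_add, map_add, mul_add, add_mul, hx, hy]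
  | hm α β =>
    obtain ⟨t, rfl⟩ := (dualTensorHomEquiv K A A).surjective α
    induction t using TensorProduct.induction_on with
    | zero => simp
    | add x y hx hy => simp only [map_add, TensorProduct.map_add_left, LinearMap.lTensor_add, mul_add, add_mul, hx, hy]
    | tmul φ z =>
      have hd : (dualTensorHomEquiv K A A) (φ ⊗ₜ z) = LinearMap.smulRight φ z := by
        ext; simp
      rw [hd, ptr_map, LinearMap.trace_smulRight, LinearMap.lTensor_smul]
      set ψ : A →ₗ[K] A := HopfAlgebra.antipode K ∘ₗ (TensorProduct.lid K A).toLinearMap ∘ₗ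
        LinearMap.rTensor A φ ∘ₗ Coalgebra.comul (R := K) with hψ
      let Op : A ⊗[K] A → Module.End K (A ⊗[K] (A ⊗[K] A)) := fun t =>
        (TensorProduct.assoc K A A A).toLinearMap ∘ₗ TensorProduct.map (LinearMap.mulLeft K t) β ∘ₗ
          LinearMap.rTensor A (TensorProduct.mk K A A 1 ∘ₗ LinearMap.mul' K A ∘ₗ LinearMap.rTensor A ψ) ∘ₗ
          (TensorProduct.assoc K A A A).symm.toLinearMap
      have mLa : ∀ x y : A ⊗[K] A, LinearMap.mulLeft K (x + y) = LinearMap.mulLeft K x + LinearMap.mulLeft K y :=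
        fun x y => LinearMap.ext fun w => add_mul x y w
      have mLa' : ∀ x y : A, LinearMap.mulLeft K (x + y) = LinearMap.mulLeft K x + LinearMap.mulLeft K y :=
        fun x y => LinearMap.ext fun w => add_mul x y w
      have e1 : ∀ t, ptr K A (A ⊗[K] A) (Op t) = TensorProduct.map (LinearMap.mulLeft K
          (LinearMap.mul' K A (TensorProduct.comm K A A (LinearMap.rTensor A ψ t)))) β := by
        intro t
        induction t using TensorProduct.induction_on with
        | zero => 
          simp only [Op, map_zero, LinearMap.mulLeft_zero_eq_zero, TensorProduct.map_zero_left, LinearMap.zero_comp, LinearMap.comp_zero]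
        | add x y hx hy =>
          have : Op (x + y) = Op x + Op y := by
            simp only [Op, mLa, TensorProduct.map_add_left, LinearMap.add_comp, LinearMap.comp_add]
          rw [this, map_add, hx, hy, map_add, map_add, map_add, mLa', TensorProduct.map_add_left]
        | tmul p q =>
          let FF : A →ₗ[K] Module.End K (A ⊗[K] A) :=
            (TensorProduct.mapBilinear (RingHom.id K) A A A A).flip β ∘ₗ LinearMap.mul K A ∘ₗ
              LinearMap.mulLeft K q ∘ₗ ψ
          have : Op (p ⊗ₜ q) = TensorProduct.lift (LinearMap.compr₂ FF (TensorProduct.mk K A (A ⊗[K] A) p)) := by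
            ext y v x
            simp [Op, FF, mul_assoc]
          rw [this, ptr_BF]
          simp only [FF, LinearMap.rTensor_tmul, TensorProduct.comm_tmul, LinearMap.mul'_apply]
          rfl
      have e2 : Th12 (Th0 K A) * (sg K A A * (TensorProduct.map (LinearMap.smulRight φ z) β).lTensor A * sg K A A) *
          Th12 (Ti0 K A) = Op (Coalgebra.comul (R := K) z) := by
        have key : ∀ (s : A ⊗[K] A) (v x : A), Th12 (Th0 K A) (sg K A A ((TensorProduct.map (LinearMap.smulRight φ z) β).lTensor A
            (sg K A A (TensorProduct.assoc K A A A ((LinearMap.lTensor A (HopfAlgebra.antipode K) s * 1 ⊗ₜ v) ⊗ₜ x))))) =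
            TensorProduct.assoc K A A A ((Coalgebra.comul (R := K) z * (1 ⊗ₜ (HopfAlgebra.antipode K (TensorProduct.lid K A (LinearMap.rTensor A φ s)) * v))) ⊗ₜ β x) := by
          intro s v x
          induction s using TensorProduct.induction_on with
          | zero => simp
          | add x y hx hy => simp only [map_add, mul_add, add_tmul, add_mul, tmul_add, hx, hy]
          | tmul p q =>
            have : sg K A A ((TensorProduct.map (LinearMap.smulRight φ z) β).lTensor A
              (sg K A A (TensorProduct.assoc K A A A ((LinearMap.lTensor A (HopfAlgebra.antipode K) (p ⊗ₜ q) * 1 ⊗ₜ v) ⊗ₜ x)))) =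
              φ p • TensorProduct.assoc K A A A ((z ⊗ₜ (HopfAlgebra.antipode K q * v)) ⊗ₜ β x) := by
              simp [sg, smul_tmul']
            rw [this, map_smul, Th12_assoc, Th0_tmul, LinearMap.rTensor_tmul, lid_tmul, map_smul, smul_mul_assoc,
              tmul_smul, mul_smul_comm, ← smul_tmul', map_smul]
        apply ext_assoc; intro w x
        induction w using TensorProduct.induction_on with
        | zero => simp
        | add x y hx hy => simp only [map_add, add_tmul, hx, hy]
        | tmul y v =>
          rw [Module.End.mul_apply, Th12_assoc, Ti0_tmul, Module.End.mul_apply, Module.End.mul_apply,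
            Module.End.mul_apply, key]
          simp [Op, ψ]
      rw [e2, e1, psi_lemma hS]
      refine TensorProduct.ext' fun a b => ?_
      simp [smul_tmul']
end base6

section base7
universe v
variable {K : Type*} {A : Type v} [Field K] [CharZero K] [Ring A] [HopfAlgebra K A] [FiniteDimensional K A]

theorem lT_pow {Y : Type*} [AddCommGroup Y] [Module K Y] (f : Module.End K Y) (n : ℕ) :
    (LinearMap.lTensor A f : Module.End K (A ⊗[K] Y)) ^ n = LinearMap.lTensor A (f ^ n) := by
  induction n with
  | zero => simp [Module.End.one_eq_id]
  | succ n ih => rw [pow_succ, ih, pow_succ, LinearMap.lTensor_mul]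

theorem conj_pow_gen {E : Type*} [Monoid E] {c c' a : E} (h : c' * c = 1) (h' : c * c' = 1) (n : ℕ) :
    (c * a * c') ^ n = c * a ^ n * c' := by
  induction n with
  | zero => simp [h']
  | succ n ih => 
    rw [pow_succ, ih, pow_succ]
    calc c * a ^ n * c' * (c * a * c') = c * a ^ n * (c' * c) * a * c' := by simp only [mul_assoc]
      _ = _ := by rw [h]; simp only [mul_assoc, one_mul]

theorem inter_pow {E : Type*} [Monoid E] {t a b : E} (h : t * a = b * t) (n : ℕ) :
    t * a ^ n = b ^ n * t := by
  induction n with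
  | zero => simp
  | succ n ih => rw [pow_succ, ← mul_assoc, ih, mul_assoc, h, pow_succ, mul_assoc]

theorem e_comm (R : A ⊗[K] A) (h4 : TensorProduct.comm K A A R * R = 1)
    (hk : kop K A R (TensorProduct.comm K A A R) = 1) (T : Module.End K (A ⊗[K] A))
    (t2 : Commute (T.lTensor A : Module.End K (A ⊗[K] (A ⊗[K] A)))
      (cc A R * T.lTensor A * cc A R)) (m n : ℕ) :
    Commute (T ^ m) ((ptr K A A (T ^ n)).lTensor A) := by
  have h := (t2.pow_left m).pow_right n
  rw [conj_pow' (E := Module.End K (A ⊗[K] (A ⊗[K] A))) (cc_cc A R h4), lT_pow, lT_pow] at h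
  have h1 := congrArg (ptr K A (A ⊗[K] A)) h.eq
  rw [ptr_lT_mul, ptr_mul_lT, ptr_cc _ _ hk] at h1
  exact h1

theorem e_fix (hS : ∀ x : A, HopfAlgebra.antipode K (HopfAlgebra.antipode K x) = x)
    (R : A ⊗[K] A) (h4 : TensorProduct.comm K A A R * R = 1)
    (hk : kop K A R (TensorProduct.comm K A A R) = 1) (T : Module.End K (A ⊗[K] A))
    (t2 : Commute (T.lTensor A : Module.End K (A ⊗[K] (A ⊗[K] A)))
      (cc A R * T.lTensor A * cc A R))
    (t3 : Th12 (Th0 K A) * (sg K A A * T.lTensor A * sg K A A) =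
      T.lTensor A * (cc A R * T.lTensor A * cc A R) * Th12 (Th0 K A)) (n : ℕ) :
    T ^ n * (ptr K A A (T ^ n)).lTensor A = (ptr K A A (T ^ n)).lTensor A := by
  have h := inter_pow (E := Module.End K (A ⊗[K] (A ⊗[K] A))) t3 n
  rw [t2.mul_pow, conj_pow' (E := Module.End K (A ⊗[K] (A ⊗[K] A))) (cc_cc A R h4), 
    conj_pow' (E := Module.End K (A ⊗[K] (A ⊗[K] A))) (sg_sg A), lT_pow] at h
  have h1 := congrArg (fun z => ptr K A (A ⊗[K] A) (z * Th12 (Ti0 K A))) h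
  rw [ptr_theta hS, mul_assoc _ (Th12 (Th0 K A)) (Th12 (Ti0 K A)), ← Th12_mul, Th0_Ti0, Th12_one, mul_one, ptr_lT_mul, 
    ptr_cc _ _ hk] at h1
  exact h1.symm

theorem T_pow_eq_one (hS : ∀ x : A, HopfAlgebra.antipode K (HopfAlgebra.antipode K x) = x)
    (R : A ⊗[K] A) (h4 : TensorProduct.comm K A A R * R = 1)
    (hy : i12 K A R * i13 K A R * i23 K A R = i23 K A R * i13 K A R * i12 K A R)
    (hk : kop K A R (TensorProduct.comm K A A R) = 1) (T : Module.End K (A ⊗[K] A))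
    (hT : Function.Injective T)
    (t2 : Commute (T.lTensor A : Module.End K (A ⊗[K] (A ⊗[K] A)))
      (cc A R * T.lTensor A * cc A R))
    (t3 : Th12 (Th0 K A) * (sg K A A * T.lTensor A * sg K A A) =
      T.lTensor A * (cc A R * T.lTensor A * cc A R) * Th12 (Th0 K A)) :
    T ^ (Module.finrank K A) = 1 := by
  set N := Module.finrank K A with hN
  rcases Nat.eq_zero_or_pos N with h0 | hpos
  · rw [h0, pow_zero]
  have hN0 : (N : K) ≠ 0 := by exact_mod_cast hpos.ne'
  obtain ⟨e, he⟩ : ∃ e : ℕ → Module.End K A, ∀ n, ptr K A A (T ^ n) = (N : K) • e n :=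
    ⟨fun n => (N : K)⁻¹ • ptr K A A (T ^ n), fun n => by rw [smul_smul, mul_inv_cancel₀ hN0, one_smul]⟩
  have canc : ∀ x y : Module.End K A, (N : K) • x = (N : K) • y → x = y := fun x y h =>
    smul_right_injective _ hN0 h
  have canc' : ∀ x y : Module.End K (A ⊗[K] A), (N : K) • x = (N : K) • y → x = y := fun x y h =>
    smul_right_injective _ hN0 h
  have e0 : e 0 = 1 := by
    apply canc
    rw [← he, pow_zero, ptr_one]
  have hc : ∀ m n, Commute (T ^ m) ((e n).lTensor A) := by
    intro m n
    have := e_comm R h4 hk T t2 m n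
    rw [he, LinearMap.lTensor_smul] at this
    apply canc'
    rw [← mul_smul_comm, ← smul_mul_assoc]; exact this.eq
  have hf : ∀ n, T ^ n * (e n).lTensor A = (e n).lTensor A := by
    intro n
    have := e_fix hS R h4 hk T t2 t3 n
    rw [he, LinearMap.lTensor_smul, mul_smul_comm] at this
    exact canc' _ _ this
  have hcc : ∀ m n, e m * e n = e n * e m := by
    intro m n
    have := congrArg (ptr K A A) (hc m n).eq
    rw [ptr_mul_lT, ptr_lT_mul, he, smul_mul_assoc, mul_smul_comm] at this
    exact canc _ _ this
  have hadd : ∀ m n, e (m + n) * e n = e m * e n := by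
    intro m n
    have h : T ^ (m + n) * (e n).lTensor A = T ^ m * (e n).lTensor A := by
      rw [pow_add, mul_assoc, hf]
    have := congrArg (ptr K A A) h
    rw [ptr_mul_lT, ptr_mul_lT, he, he, smul_mul_assoc, smul_mul_assoc] at this
    exact canc _ _ this
  have hid : ∀ n, e n * e n = e n := by
    intro n
    have := hadd 0 n
    rwa [zero_add, e0, one_mul] at this
  have hmul : ∀ d j, e (d * j) * e d = e d := by
    intro d j
    induction j with
    | zero => rw [mul_zero, e0, one_mul]
    | succ j ih => rw [Nat.mul_succ, hadd, ih]
  set f : Module.End K A := 1 - e N with hfdef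
  have hfi : f * f = f := by
    rw [hfdef]; simp [mul_sub, sub_mul, hid]
  have hef : ∀ n, e n * f = f * e n := by
    intro n; rw [hfdef, mul_sub, sub_mul, hcc]; simp
  have hTf : Commute T (f.lTensor A) := by
    rw [hfdef, LinearMap.lTensor_sub]
    have h1 := hc 1 N
    rw [pow_one] at h1
    have h2 : (LinearMap.lTensor A (1 : Module.End K A)) = (1 : Module.End K (A ⊗[K] A)) := by simp [Module.End.one_eq_id]
    rw [h2]
    exact (Commute.one_right T).sub_right h1
  have hf0 : f = 0 := by
    by_contra hne
    by_cases hall : ∃ n, 0 < n ∧ e n * f ≠ 0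
    · classical
      let d := Nat.find hall
      obtain ⟨hd, hdf⟩ : 0 < d ∧ e d * f ≠ 0 := Nat.find_spec hall
      have hmin : ∀ i, 0 < i → i < d → e i * f = 0 := by
        intro i hi hid
        have := Nat.find_min hall hid
        push Not at this
        exact this hi
      have hdN : d ∣ N := by
        refine lemM_dvd R h4 hy hk hd A T (e d * f) ?_ hdf t2 ?_ ?_ ?_
        · unfold IsIdempotentElem
          calc e d * f * (e d * f) = e d * (f * e d) * f := by simp only [mul_assoc]
            _ = (e d * e d) * (f * f) := by rw [← hef]; simp only [mul_assoc]
            _ = _ := by rw [hid, hfi]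
        · rw [LinearMap.lTensor_mul]
          have h1 := hc 1 d
          rw [pow_one] at h1
          exact h1.mul_right hTf
        · rw [LinearMap.lTensor_mul, ← mul_assoc, hf]
        · intro i hi hi'
          rw [he, smul_mul_assoc, ← mul_assoc, hcc i d, mul_assoc, hmin i hi hi']
          simp
      obtain ⟨j, hj⟩ := hdN
      apply hdf
      have h1 := hmul d j
      rw [← hj, hcc] at h1
      rw [hfdef, mul_sub, mul_one, h1, sub_self]
    · push Not at hall
      have hcoef := LinearMap.minpoly_coeff_zero_of_injective (f := T) hT
      apply hne
      have h1 := minpoly.aeval K T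
      rw [Polynomial.aeval_eq_sum_range] at h1
      have h2 := congrArg (fun z => ptr K A A (z * f.lTensor A)) h1
      simp only [Finset.sum_mul, map_sum, zero_mul, map_zero, smul_mul_assoc, map_smul, ptr_mul_lT, he] at h2
      rw [Finset.sum_range_succ', Finset.sum_eq_zero, zero_add, e0, one_mul] at h2
      · simpa [hcoef, hN0] using h2
      · intro i _
        rw [hall (i+1) (Nat.succ_pos i)]; simp
  have heN : e N = 1 := (sub_eq_zero.1 hf0).symm
  have := hf N
  rw [heN] at this
  have h2 : (LinearMap.lTensor A (1 : Module.End K A)) = (1 : Module.End K (A ⊗[K] A)) := by simp [Module.End.one_eq_id]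
  rwa [h2, mul_one] at this

theorem GG_eq : GG K A = (TensorProduct.comm K A A).toLinearMap ∘ₗ Th0 K A ∘ₗ (TensorProduct.comm K A A).toLinearMap := by
  refine TensorProduct.ext' fun v x => ?_
  rw [GG_tmul]
  simp only [LinearMap.comp_apply, LinearEquiv.coe_coe, comm_tmul, Th0_tmul]
  rw [comm_mul', comm_tmul]

theorem GG_injective : Function.Injective (GG K A) := by
  rw [GG_eq]
  have h : Ti0 K A * Th0 K A = 1 := mul_eq_one_comm.1 Th0_Ti0
  have h2 : Function.Injective (Th0 K A) := by
    intro x y hxy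
    have := congrArg (Ti0 K A) hxy
    rwa [← Module.End.mul_apply, ← Module.End.mul_apply, h] at this
  simp only [LinearMap.coe_comp, LinearEquiv.coe_coe]
  exact (LinearEquiv.injective _).comp (h2.comp (LinearEquiv.injective _))

theorem GG_pow_eq_one (hS : ∀ x : A, HopfAlgebra.antipode K (HopfAlgebra.antipode K x) = x) (R : A ⊗[K] A)
    (hr1 : TensorProduct.assoc K A A A (LinearMap.rTensor A (Coalgebra.comul (R := K)) R) =
      i13 K A R * i23 K A R)
    (hr2 : LinearMap.lTensor A ((TensorProduct.comm K A A).toLinearMap ∘ₗ Coalgebra.comul (R := K)) R =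
      i12 K A R * i13 K A R)
    (hR3 : ∀ x : A, R * Coalgebra.comul (R := K) x
      = TensorProduct.comm K A A (Coalgebra.comul (R := K) x) * R)
    (h4 : TensorProduct.comm K A A R * R = 1) (h4' : R * TensorProduct.comm K A A R = 1)
    (hy : i12 K A R * i13 K A R * i23 K A R = i23 K A R * i13 K A R * i12 K A R)
    (hk : kop K A R (TensorProduct.comm K A A R) = 1) :
    GG K A ^ (Module.finrank K A) = 1 := by
  obtain ⟨t2, t3⟩ := TT_T23 R hr1 hr2 hR3 h4 h4' hy
  set a : Module.End K (A ⊗[K] A) := LinearMap.mulLeft K (TensorProduct.comm K A A R) with ha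
  set b : Module.End K (A ⊗[K] A) := LinearMap.mulLeft K R with hb
  have hab : a * b = 1 := by
    rw [ha, hb, Module.End.mul_eq_comp, ← LinearMap.mulLeft_mul, h4, LinearMap.mulLeft_one]; rfl
  have hba : b * a = 1 := by
    rw [ha, hb, Module.End.mul_eq_comp, ← LinearMap.mulLeft_mul, h4', LinearMap.mulLeft_one]; rfl
  have inj : ∀ x y : Module.End K (A ⊗[K] A), x * y = 1 → Function.Injective y := by
    intro x y h u v huv
    have := congrArg x huv
    rwa [← Module.End.mul_apply, ← Module.End.mul_apply, h] at this
  have hTi : Function.Injective (TT R) := by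
    have : (TT R : A ⊗[K] A → A ⊗[K] A) = a ∘ (GG K A) ∘ b := rfl
    rw [this]
    exact (inj b a hba).comp (GG_injective.comp (inj a b hab))
  have h1 := T_pow_eq_one hS R h4 hy hk (TT R) hTi t2 t3
  have h2 : TT R = a * GG K A * b := rfl
  rw [h2, conj_pow_gen (E := Module.End K (A ⊗[K] A)) hba hab] at h1
  calc GG K A ^ (Module.finrank K A) = b * a * GG K A ^ (Module.finrank K A) * (b * a) := by rw [hba]; simp
    _ = b * (a * GG K A ^ (Module.finrank K A) * b) * a := by simp only [mul_assoc]
    _ = 1 := by rw [h1, mul_one, hba]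
end base7

section base8
universe v
variable {K : Type*} {A : Type v} [Field K] [Ring A] [HopfAlgebra K A] 

def JJ (P : A →ₗ[K] A) : Module.End K (A ⊗[K] A) :=
  TensorProduct.lift ((LinearMap.mul K (A ⊗[K] A)).compl₁₂
    (LinearMap.lTensor A P ∘ₗ Coalgebra.comul (R := K)) (TensorProduct.mk K A A 1))

theorem JJ_tmul (P : A →ₗ[K] A) (x v : A) : JJ P (x ⊗ₜ v) =
    LinearMap.lTensor A P (Coalgebra.comul (R := K) x) * (1 ⊗ₜ v) := by
  simp [JJ]

theorem JJ_counit : JJ (counitUnit K A) = 1 := by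
  refine TensorProduct.ext' fun x v => ?_
  have h : counitUnit K A = Algebra.linearMap K A ∘ₗ Coalgebra.counit := rfl
  rw [JJ_tmul, h, LinearMap.lTensor_comp, LinearMap.comp_apply, Coalgebra.lTensor_counit_comul]
  simp

theorem JJ_inj (P : A →ₗ[K] A) (h : JJ P = 1) : P = counitUnit K A := by
  have h1 : ∀ x, LinearMap.lTensor A P (Coalgebra.comul (R := K) x) = x ⊗ₜ 1 := by
    intro x
    have := LinearMap.congr_fun h (x ⊗ₜ 1)
    rw [JJ_tmul, ← Algebra.TensorProduct.one_def, mul_one] at this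
    exact this
  ext x
  have h2 := congrArg (fun t => TensorProduct.lid K A (LinearMap.rTensor A (Coalgebra.counit (R := K)) t)) (h1 x)
  have h3 : ∀ t : A ⊗[K] A, TensorProduct.lid K A (LinearMap.rTensor A (Coalgebra.counit (R := K)) (LinearMap.lTensor A P t)) =
    P (TensorProduct.lid K A (LinearMap.rTensor A (Coalgebra.counit (R := K)) t)) := by
    intro t
    induction t using TensorProduct.induction_on with
    | zero => simp
    | add x y hx hy => simp only [map_add, hx, hy]
    | tmul a b => simp
  rw [h3, Coalgebra.rTensor_counit_comul] at h2
  simpa [counitUnit, Algebra.algebraMap_eq_smul_one] using h2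

theorem JJ_mul (P : A →ₗ[K] A) : JJ P * Th0 K A = JJ (conv K A P LinearMap.id) := by
  refine TensorProduct.ext' fun y v => ?_
  rw [Module.End.mul_apply, Th0_tmul, JJ_tmul]
  let F : A ⊗[K] (A ⊗[K] A) →ₗ[K] A ⊗[K] A :=
    LinearMap.lTensor A (LinearMap.mulRight K v ∘ₗ LinearMap.mul' K A ∘ₗ LinearMap.rTensor A P)
  have e3 : ∀ (s : A ⊗[K] A) (q : A), LinearMap.lTensor A P s * (1 ⊗ₜ (q * v)) = F (TensorProduct.assoc K A A A (s ⊗ₜ q)) := by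
    intro s q
    induction s using TensorProduct.induction_on with
    | zero => simp
    | add x y hx hy => simp only [map_add, add_mul, add_tmul, hx, hy]
    | tmul a b => simp [F, mul_assoc]
  have e2 : ∀ t : A ⊗[K] A, JJ P (t * (1 ⊗ₜ v)) =
      F (TensorProduct.assoc K A A A (LinearMap.rTensor A (Coalgebra.comul (R := K)) t)) := by
    intro t
    induction t using TensorProduct.induction_on with
    | zero => simp
    | add x y hx hy => simp only [map_add, add_mul, hx, hy]
    | tmul a b => rw [LinearMap.rTensor_tmul, ← e3, Algebra.TensorProduct.tmul_mul_tmul, JJ_tmul, mul_one]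
  have e4 : ∀ t : A ⊗[K] A, F (LinearMap.lTensor A (Coalgebra.comul (R := K)) t) =
      LinearMap.lTensor A (conv K A P LinearMap.id) t * (1 ⊗ₜ v) := by
    intro t
    induction t using TensorProduct.induction_on with
    | zero => simp
    | add x y hx hy => simp only [map_add, add_mul, hx, hy]
    | tmul a b =>
      simp only [F, LinearMap.lTensor_tmul, LinearMap.comp_apply, conv, LinearMap.rTensor,
        LinearMap.mulRight_apply, Algebra.TensorProduct.tmul_mul_tmul, mul_one]
  rw [e2, Coalgebra.coassoc_apply, e4]

theorem JJ_id : JJ LinearMap.id = Th0 K A := by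
  refine TensorProduct.ext' fun x v => ?_
  rw [JJ_tmul, Th0_tmul]; simp

theorem Th0_pow (Sinv : A →ₗ[K] A) (hS : Sinv ∘ₗ Sinv = LinearMap.id) (n : ℕ) :
    Th0 K A ^ (n+1) = JJ (expMap K A Sinv (n+1)) := by
  induction n with
  | zero => simp [expMap, JJ_id]
  | succ n ih =>
    have : ((Sinv ∘ₗ Sinv) ^ (n+1) : Module.End K A) = LinearMap.id := by
      rw [hS, ← Module.End.one_eq_id, one_pow]
    rw [pow_succ, ih, JJ_mul, expMap, this]

theorem exp_final [FiniteDimensional K A] (Sinv : A →ₗ[K] A) (hS : Sinv ∘ₗ Sinv = LinearMap.id)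
    (h : GG K A ^ (Module.finrank K A) = 1) :
    hopfExponent K A Sinv ≠ 0 ∧ hopfExponent K A Sinv ∣ Module.finrank K A := by
  have hnt : Nontrivial A := by
    refine ⟨0, 1, fun h01 => ?_⟩
    have := congrArg (Coalgebra.counit (R := K)) h01
    simp at this
  have hpos : 0 < Module.finrank K A := Module.finrank_pos
  have hT : Th0 K A ^ (Module.finrank K A) = 1 := by
    set c : Module.End K (A ⊗[K] A) := (TensorProduct.comm K A A).toLinearMap with hc
    have hcc : c * c = 1 := by
      refine TensorProduct.ext' fun x y => ?_
      simp [hc]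
    have e : Th0 K A = c * GG K A * c := by
      have : GG K A = c * Th0 K A * c := by
        refine TensorProduct.ext' fun x v => ?_
        simp only [hc, Module.End.mul_apply, LinearEquiv.coe_coe, comm_tmul, GG_tmul, Th0_tmul]
        rw [comm_mul', comm_tmul]
      rw [this]
      calc Th0 K A = (c * c) * Th0 K A * (c * c) := by rw [hcc]; simp
        _ = _ := by simp only [mul_assoc]
    rw [e, conj_pow' (E := Module.End K (A ⊗[K] A)) hcc, h, mul_one, hcc]
  have hiff : ∀ n, 0 < n → (expMap K A Sinv n = counitUnit K A ↔ Th0 K A ^ n = 1) := by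
    intro n hn
    obtain ⟨m, rfl⟩ := Nat.exists_eq_succ_of_ne_zero hn.ne'
    rw [Nat.succ_eq_add_one, Th0_pow Sinv hS]
    constructor
    · intro h; rw [h, JJ_counit]
    · exact JJ_inj _
  have hfin : IsOfFinOrder (Th0 K A) := isOfFinOrder_iff_pow_eq_one.2 ⟨_, hpos, hT⟩
  have key : hopfExponent K A Sinv = orderOf (Th0 K A) := by
    have hmem : orderOf (Th0 K A) ∈ {n : ℕ | 0 < n ∧ expMap K A Sinv n = counitUnit K A} :=
      ⟨hfin.orderOf_pos, (hiff _ hfin.orderOf_pos).2 (pow_orderOf_eq_one _)⟩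
    apply le_antisymm
    · exact Nat.sInf_le hmem
    · obtain ⟨h1, h2⟩ := Nat.sInf_mem ⟨_, hmem⟩
      exact orderOf_le_of_pow_eq_one h1 ((hiff _ h1).1 h2)
  rw [key]
  exact ⟨hfin.orderOf_pos.ne', orderOf_dvd_of_pow_eq_one hT⟩
end base8

section base9
universe v
variable {K : Type*} {A : Type v} [Field K] [Ring A] [HopfAlgebra K A] 

local notation "SS" => HopfAlgebra.antipode K (A := A)
local notation "ΔΔ" => Coalgebra.comul (R := K) (A := A)
local notation "εε" => Coalgebra.counit (R := K) (A := A)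

theorem sw {M : Type*} [AddCommGroup M] [Module K M] (Φ : A ⊗[K] (A ⊗[K] A) →ₗ[K] M) (g1 g2 : A ⊗[K] A →ₗ[K] M)
    (h1 : ∀ p q, g1 (p ⊗ₜ q) = Φ (TensorProduct.assoc K A A A (ΔΔ p ⊗ₜ q)))
    (h2 : ∀ p q, g2 (p ⊗ₜ q) = Φ (p ⊗ₜ ΔΔ q)) (x : A) : g1 (ΔΔ x) = g2 (ΔΔ x) := by
  have e1 : g1 = Φ ∘ₗ (TensorProduct.assoc K A A A).toLinearMap ∘ₗ LinearMap.rTensor A ΔΔ :=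
    TensorProduct.ext' fun p q => by rw [h1]; rfl
  have e2 : g2 = Φ ∘ₗ LinearMap.lTensor A ΔΔ :=
    TensorProduct.ext' fun p q => by rw [h2]; rfl
  rw [e1, e2]
  simp only [LinearMap.comp_apply, LinearEquiv.coe_coe, Coalgebra.coassoc_apply]

theorem SL1 (x : A) : TensorProduct.lift ((LinearMap.mul K (A ⊗[K] A)).compl₁₂
    ((TensorProduct.mk K A A).flip 1 ∘ₗ SS) ΔΔ) (ΔΔ x) = 1 ⊗ₜ x := by
  rw [← sw (TensorProduct.map (LinearMap.mul' K A) LinearMap.id ∘ₗ (TensorProduct.assoc K A A A).symm.toLinearMap ∘ₗ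
    LinearMap.rTensor (A ⊗[K] A) SS) (LinearMap.rTensor A (Algebra.linearMap K A ∘ₗ εε)) _ _ _ x]
  · rw [LinearMap.rTensor_comp, LinearMap.comp_apply, Coalgebra.rTensor_counit_comul]
    simp
  · intro p q
    have : ∀ s : A ⊗[K] A, (TensorProduct.map (LinearMap.mul' K A) LinearMap.id ∘ₗ (TensorProduct.assoc K A A A).symm.toLinearMap ∘ₗ
    LinearMap.rTensor (A ⊗[K] A) SS) (TensorProduct.assoc K A A A (s ⊗ₜ q)) = LinearMap.mul' K A (LinearMap.rTensor A SS s) ⊗ₜ q := by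
      intro s
      induction s using TensorProduct.induction_on with
      | zero => simp
      | add x y hx hy => simp only [map_add, add_tmul, hx, hy]
      | tmul a b => simp
    rw [this, HopfAlgebra.mul_antipode_rTensor_comul_apply]
    simp
  · intro p q
    simp only [lift.tmul, LinearMap.compl₁₂_apply, LinearMap.comp_apply, LinearMap.flip_apply, TensorProduct.mk_apply,
      LinearMap.mul_apply', LinearMap.rTensor_tmul]
    generalize ΔΔ q = s
    induction s using TensorProduct.induction_on with
    | zero => simp
    | add x y hx hy => simp only [map_add, tmul_add, mul_add, hx, hy]
    | tmul a b => simp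

theorem comul_antipode' (x : A) : ΔΔ (SS x) = TensorProduct.map SS SS (TensorProduct.comm K A A (ΔΔ x)) := by
  let G : A →ₗ[K] A ⊗[K] A := TensorProduct.map SS SS ∘ₗ (TensorProduct.comm K A A).toLinearMap ∘ₗ ΔΔ
  have hG : WithConv.toConv G * WithConv.toConv ΔΔ = 1 := by
    apply WithConv.ext
    simp only [LinearMap.convMul_def, LinearMap.convOne_def, WithConv.ofConv_toConv]
    refine LinearMap.ext fun x => ?_
    have := sw (K := K) (A := A) (TensorProduct.lift ((LinearMap.mul K (A ⊗[K] A)).compl₁₂ 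
      (TensorProduct.mk K A A 1 ∘ₗ SS) (TensorProduct.lift ((LinearMap.mul K (A ⊗[K] A)).compl₁₂
    ((TensorProduct.mk K A A).flip 1 ∘ₗ SS) ΔΔ))))
      (LinearMap.mul' K (A ⊗[K] A) ∘ₗ TensorProduct.map G ΔΔ)
      (TensorProduct.mk K A A 1 ∘ₗ LinearMap.mul' K A ∘ₗ LinearMap.rTensor A SS) ?_ ?_ x
    · rw [LinearMap.comp_apply] at this
      rw [LinearMap.comp_apply, LinearMap.comp_apply, this, LinearMap.comp_apply, LinearMap.comp_apply, 
        HopfAlgebra.mul_antipode_rTensor_comul_apply]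
      simp [Algebra.algebraMap_eq_smul_one, Algebra.TensorProduct.one_def]
    · intro p q
      simp only [LinearMap.comp_apply, map_tmul, LinearMap.mul'_apply, G, LinearEquiv.coe_coe]
      generalize ΔΔ p = s
      induction s using TensorProduct.induction_on with
      | zero => simp
      | add x y hx hy => simp only [map_add, add_tmul, add_mul, hx, hy]
      | tmul a b => simp [← mul_assoc]
    · intro p q
      simp only [lift.tmul, LinearMap.compl₁₂_apply, LinearMap.comp_apply]
      rw [SL1]
      simp
  have := left_inv_eq_right_inv hG LinearMap.comul_right_inv
  have h2 := congrArg WithConv.ofConv this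
  exact (LinearMap.congr_fun h2 x).symm
end base9

section base10
universe v
variable {K : Type*} {A : Type v} [Field K] [Ring A] [HopfAlgebra K A] 

local notation "SS" => HopfAlgebra.antipode K (A := A)
local notation "ΔΔ" => Coalgebra.comul (R := K) (A := A)
local notation "εε" => Coalgebra.counit (R := K) (A := A)

theorem get_hr1 (R : A ⊗[K] A)
    (hR1 : TensorProduct.map (Coalgebra.comul (R := K)) LinearMap.id R
      = (TensorProduct.map ((TensorProduct.mk K A A).flip 1) LinearMap.id R)
        * (TensorProduct.map (TensorProduct.mk K A A 1) LinearMap.id R)) :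
    TensorProduct.assoc K A A A (LinearMap.rTensor A ΔΔ R) = i13 K A R * i23 K A R := by
  have h := congrArg (TensorProduct.assoc K A A A) hR1
  rw [assoc_mul'] at h
  have e1 : ∀ x : A ⊗[K] A, TensorProduct.assoc K A A A (TensorProduct.map ((TensorProduct.mk K A A).flip 1) LinearMap.id x) = i13 K A x := by
    intro x
    induction x using TensorProduct.induction_on with
    | zero => simp
    | add x y hx hy => simp only [map_add, hx, hy]
    | tmul a b => simp [i13]
  have e2 : ∀ x : A ⊗[K] A, TensorProduct.assoc K A A A (TensorProduct.map (TensorProduct.mk K A A 1) LinearMap.id x) = i23 K A x := by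
    intro x
    induction x using TensorProduct.induction_on with
    | zero => simp
    | add x y hx hy => simp only [map_add, hx, hy]
    | tmul a b => simp [i23]
  rw [e1, e2] at h
  exact h

theorem get_hr2' (R : A ⊗[K] A)
    (hR2 : (TensorProduct.assoc K A A A).symm
        (TensorProduct.map LinearMap.id (Coalgebra.comul (R := K)) R)
      = (TensorProduct.map ((TensorProduct.mk K A A).flip 1) LinearMap.id R)
        * (R ⊗ₜ[K] (1 : A))) :
    LinearMap.lTensor A ΔΔ R = i13 K A R * i12 K A R := by
  have h := congrArg (TensorProduct.assoc K A A A) hR2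
  rw [assoc_mul', LinearEquiv.apply_symm_apply] at h
  have e1 : ∀ x : A ⊗[K] A, TensorProduct.assoc K A A A (TensorProduct.map ((TensorProduct.mk K A A).flip 1) LinearMap.id x) = i13 K A x := by
    intro x
    induction x using TensorProduct.induction_on with
    | zero => simp
    | add x y hx hy => simp only [map_add, hx, hy]
    | tmul a b => simp [i13]
  have e2 : ∀ x : A ⊗[K] A, TensorProduct.assoc K A A A (x ⊗ₜ 1) = i12 K A x := by
    intro x
    induction x using TensorProduct.induction_on with
    | zero => simp
    | add x y hx hy => simp only [map_add, add_tmul, hx, hy]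
    | tmul a b => simp [i12]
  rw [e1, e2] at h
  exact h

theorem get_hr2 (R : A ⊗[K] A) (hr2' : LinearMap.lTensor A ΔΔ R = i13 K A R * i12 K A R) :
    LinearMap.lTensor A ((TensorProduct.comm K A A).toLinearMap ∘ₗ ΔΔ) R = i12 K A R * i13 K A R := by
  rw [LinearMap.lTensor_comp, LinearMap.comp_apply, hr2']
  have : ∀ x y : A ⊗[K] A, LinearMap.lTensor A (TensorProduct.comm K A A).toLinearMap (i13 K A x * i12 K A y) = i12 K A x * i13 K A y := by
    intro x y
    induction x using TensorProduct.induction_on with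
    | zero => simp
    | add x y hx hy => simp only [map_add, add_mul, hx, hy]
    | tmul a b =>
      induction y using TensorProduct.induction_on with
      | zero => simp
      | add x y hx hy => simp only [map_add, mul_add, hx, hy]
      | tmul c d => simp [i12, i13]
  exact this R R

theorem get_hy (R : A ⊗[K] A)
    (hr1 : TensorProduct.assoc K A A A (LinearMap.rTensor A ΔΔ R) = i13 K A R * i23 K A R)
    (hR3 : ∀ x : A, R * ΔΔ x = TensorProduct.comm K A A (ΔΔ x) * R) :
    i12 K A R * i13 K A R * i23 K A R = i23 K A R * i13 K A R * i12 K A R := by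
  have e0 : ∀ (x z : A ⊗[K] A) (b : A), TensorProduct.assoc K A A A ((x * z) ⊗ₜ b) = i12 K A x * TensorProduct.assoc K A A A (z ⊗ₜ b) := by
    intro x z b
    have e2 : ∀ x : A ⊗[K] A, TensorProduct.assoc K A A A (x ⊗ₜ 1) = i12 K A x := by
      intro x
      induction x using TensorProduct.induction_on with
      | zero => simp
      | add x y hx hy => simp only [map_add, add_tmul, hx, hy]
      | tmul a b => simp [i12]
    rw [← e2, ← assoc_mul', Algebra.TensorProduct.tmul_mul_tmul, one_mul]
  have e0' : ∀ (x z : A ⊗[K] A) (b : A), TensorProduct.assoc K A A A ((x * z) ⊗ₜ b) = TensorProduct.assoc K A A A (x ⊗ₜ b) * i12 K A z := by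
    intro x z b
    have e2 : ∀ x : A ⊗[K] A, TensorProduct.assoc K A A A (x ⊗ₜ 1) = i12 K A x := by
      intro x
      induction x using TensorProduct.induction_on with
      | zero => simp
      | add x y hx hy => simp only [map_add, add_tmul, hx, hy]
      | tmul a b => simp [i12]
    rw [← e2, ← assoc_mul', Algebra.TensorProduct.tmul_mul_tmul, mul_one]
  have e1 : ∀ x : A ⊗[K] A, i12 K A R * TensorProduct.assoc K A A A (LinearMap.rTensor A ΔΔ x) =
      TensorProduct.leftComm K A A A (TensorProduct.assoc K A A A (LinearMap.rTensor A ΔΔ x)) * i12 K A R := by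
    intro x
    induction x using TensorProduct.induction_on with
    | zero => simp
    | add x y hx hy => simp only [map_add, add_mul, mul_add, hx, hy]
    | tmul a b =>
      rw [LinearMap.rTensor_tmul, ← e0, hR3, e0']
      congr 1
      generalize ΔΔ a = s
      induction s using TensorProduct.induction_on with
      | zero => simp
      | add x y hx hy => simp only [map_add, add_tmul, hx, hy]
      | tmul c d => simp
  have e3 : ∀ x y : A ⊗[K] A, TensorProduct.leftComm K A A A (i13 K A x * i23 K A y) = i23 K A x * i13 K A y := by
    intro x y
    induction x using TensorProduct.induction_on with
    | zero => simp
    | add x y hx hy => simp only [map_add, add_mul, hx, hy]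
    | tmul a b =>
      induction y using TensorProduct.induction_on with
      | zero => simp
      | add x y hx hy => simp only [map_add, mul_add, hx, hy]
      | tmul c d => simp [i23, i13]
  have := e1 R
  rw [hr1, e3, ← mul_assoc] at this
  exact this

theorem get_h4' (R : A ⊗[K] A) (hu : IsUnit R) (h4 : TensorProduct.comm K A A R * R = 1) :
    R * TensorProduct.comm K A A R = 1 := by
  obtain ⟨u, rfl⟩ := hu
  have := left_inv_eq_right_inv h4 u.mul_inv
  rw [this, u.mul_inv]

theorem eps_R (R : A ⊗[K] A) (hr1 : TensorProduct.assoc K A A A (LinearMap.rTensor A ΔΔ R) = i13 K A R * i23 K A R)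
    (h4' : R * TensorProduct.comm K A A R = 1) : TensorProduct.lid K A (LinearMap.rTensor A εε R) = 1 := by
  have e1 : ∀ x : A ⊗[K] A, TensorProduct.lid K (A ⊗[K] A) (LinearMap.rTensor (A ⊗[K] A) εε
      (TensorProduct.assoc K A A A (LinearMap.rTensor A ΔΔ x))) = x := by
    intro x
    induction x using TensorProduct.induction_on with
    | zero => simp
    | add x y hx hy => simp only [map_add, hx, hy]
    | tmul a b => 
      have : ∀ s : A ⊗[K] A, TensorProduct.lid K (A ⊗[K] A) (LinearMap.rTensor (A ⊗[K] A) εε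
        (TensorProduct.assoc K A A A (s ⊗ₜ b))) = TensorProduct.lid K A (LinearMap.rTensor A εε s) ⊗ₜ b := by
        intro s
        induction s using TensorProduct.induction_on with
        | zero => simp
        | add x y hx hy => simp only [map_add, add_tmul, hx, hy]
        | tmul c d => simp [smul_tmul']
      rw [LinearMap.rTensor_tmul, this, Coalgebra.rTensor_counit_comul]; simp
  have e2 : ∀ x y : A ⊗[K] A, TensorProduct.lid K (A ⊗[K] A) (LinearMap.rTensor (A ⊗[K] A) εε (i13 K A x * i23 K A y)) =
      (1 ⊗ₜ TensorProduct.lid K A (LinearMap.rTensor A εε x)) * y := by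
    intro x y
    induction x using TensorProduct.induction_on with
    | zero => simp
    | add x y hx hy => simp only [map_add, add_mul, tmul_add, hx, hy]
    | tmul a b => simp [i13, i23]
  have h := e1 R
  rw [hr1, e2] at h
  have h2 := congrArg (· * TensorProduct.comm K A A R) h
  simp only [mul_assoc, h4', mul_one] at h2
  have h3 := congrArg (fun t => TensorProduct.lid K A (LinearMap.rTensor A εε t)) h2
  simpa [Algebra.TensorProduct.one_def] using h3

theorem S_R (R : A ⊗[K] A) (hr1 : TensorProduct.assoc K A A A (LinearMap.rTensor A ΔΔ R) = i13 K A R * i23 K A R)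
    (h4' : R * TensorProduct.comm K A A R = 1) : LinearMap.rTensor A SS R = TensorProduct.comm K A A R := by
  let F : A ⊗[K] (A ⊗[K] A) →ₗ[K] A ⊗[K] A := TensorProduct.map (LinearMap.mul' K A) LinearMap.id ∘ₗ (TensorProduct.assoc K A A A).symm.toLinearMap ∘ₗ
    LinearMap.rTensor (A ⊗[K] A) SS
  have e1 : ∀ x : A ⊗[K] A, F (TensorProduct.assoc K A A A (LinearMap.rTensor A ΔΔ x)) = 
      1 ⊗ₜ TensorProduct.lid K A (LinearMap.rTensor A εε x) := by
    intro x
    induction x using TensorProduct.induction_on with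
    | zero => simp
    | add x y hx hy => simp only [map_add, tmul_add, hx, hy]
    | tmul a b => 
      have : ∀ s : A ⊗[K] A, F (TensorProduct.assoc K A A A (s ⊗ₜ b)) = LinearMap.mul' K A (LinearMap.rTensor A SS s) ⊗ₜ b := by
        intro s
        induction s using TensorProduct.induction_on with
        | zero => simp
        | add x y hx hy => simp only [map_add, add_tmul, hx, hy]
        | tmul c d => simp [F]
      rw [LinearMap.rTensor_tmul, this, HopfAlgebra.mul_antipode_rTensor_comul_apply]
      simp [Algebra.algebraMap_eq_smul_one, smul_tmul]
  have e2 : ∀ x y : A ⊗[K] A, F (i13 K A x * i23 K A y) = LinearMap.rTensor A SS x * y := by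
    intro x y
    induction x using TensorProduct.induction_on with
    | zero => simp
    | add x y hx hy => simp only [map_add, add_mul, hx, hy]
    | tmul a b =>
      induction y using TensorProduct.induction_on with
      | zero => simp
      | add x y hx hy => simp only [map_add, mul_add, hx, hy]
      | tmul c d => simp [i13, i23, F]
  have h := e1 R
  rw [hr1, e2, eps_R R hr1 h4', ← Algebra.TensorProduct.one_def] at h
  exact left_inv_eq_right_inv h h4'

theorem S_R' (R : A ⊗[K] A) (h : LinearMap.rTensor A SS R = TensorProduct.comm K A A R) :
    LinearMap.lTensor A SS (TensorProduct.comm K A A R) = R := by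
  have e : ∀ x : A ⊗[K] A, LinearMap.lTensor A SS (TensorProduct.comm K A A x) = TensorProduct.comm K A A (LinearMap.rTensor A SS x) := by
    intro x
    induction x using TensorProduct.induction_on with
    | zero => simp
    | add x y hx hy => simp only [map_add, hx, hy]
    | tmul a b => simp
  rw [e, h]; simp

theorem SS_R (R : A ⊗[K] A) (h : LinearMap.rTensor A SS R = TensorProduct.comm K A A R) :
    TensorProduct.map SS SS R = R := by
  rw [← LinearMap.lTensor_comp_rTensor, LinearMap.comp_apply, h, S_R' R h]

theorem get_hk (R : A ⊗[K] A) (h : LinearMap.rTensor A SS R = TensorProduct.comm K A A R)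
    (h4 : TensorProduct.comm K A A R * R = 1) (hS : ∀ x, SS (SS x) = x) : kop K A R (TensorProduct.comm K A A R) = 1 := by
  have e : ∀ x y : A ⊗[K] A, LinearMap.lTensor A SS (x * y) = kop K A (LinearMap.lTensor A SS x) (LinearMap.lTensor A SS y) := by
    intro x y
    induction x using TensorProduct.induction_on with
    | zero => simp
    | add x y hx hy => simp only [map_add, add_mul, LinearMap.add_apply, hx, hy]
    | tmul a b =>
      induction y using TensorProduct.induction_on with
      | zero => simp
      | add x y hx hy => simp only [map_add, mul_add, hx, hy]
      | tmul c d => simp [kop_tmul, HopfAlgebra.antipode_mul_antidistrib]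
  have h1 := e (TensorProduct.comm K A A R) R
  have h2 : LinearMap.lTensor A SS R = TensorProduct.comm K A A R := by
    have h3 := congrArg (LinearMap.lTensor A SS) (S_R' R h)
    rw [← LinearMap.comp_apply, ← LinearMap.lTensor_comp] at h3
    have : SS ∘ₗ SS = LinearMap.id := LinearMap.ext hS
    rw [this] at h3
    simpa using h3.symm
  rw [h4, S_R' R h, h2] at h1
  rw [← h1, Algebra.TensorProduct.one_def]
  simp
end base10

section base11
universe v
variable {K : Type*} {A : Type v} [Field K] [Ring A] [HopfAlgebra K A] 

local notation "SS" => HopfAlgebra.antipode K (A := A)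
local notation "ΔΔ" => Coalgebra.comul (R := K) (A := A)
local notation "εε" => Coalgebra.counit (R := K) (A := A)

def Gu (K A : Type*) [Field K] [Ring A] [HopfAlgebra K A] : A ⊗[K] A →ₗ[K] A :=
  LinearMap.mul' K A ∘ₗ (TensorProduct.comm K A A).toLinearMap ∘ₗ LinearMap.lTensor A (HopfAlgebra.antipode K)

theorem Gu_tmul (p q : A) : Gu K A (p ⊗ₜ q) = SS q * p := by simp [Gu]

def Lu (u : A) : A ⊗[K] A →ₗ[K] A :=
  TensorProduct.lift ((LinearMap.mul K A ∘ₗ LinearMap.mulRight K u ∘ₗ SS).flip)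

theorem Lu_tmul (u p q : A) : Lu (K := K) u (p ⊗ₜ q) = SS q * u * p := by simp [Lu]

theorem Gu_mul_left (x s : A ⊗[K] A) : Gu K A (x * s) = Lu (Gu K A x) s := by
  induction s using TensorProduct.induction_on with
  | zero => simp
  | add x y hx hy => simp only [map_add, mul_add, hx, hy]
  | tmul p q =>
    induction x using TensorProduct.induction_on with
    | zero => simp [Lu_tmul]
    | add x y hx hy => simp only [map_add, add_mul, mul_add, hx, hy, Lu_tmul]
    | tmul c d =>
      simp only [Algebra.TensorProduct.tmul_mul_tmul, Gu_tmul, Lu_tmul, HopfAlgebra.antipode_mul_antidistrib, mul_assoc]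

theorem Gu_mul_right (x y : A ⊗[K] A) (c : K) (h : Gu K A x = c • (1 : A)) : Gu K A (x * y) = c • Gu K A y := by
  rw [Gu_mul_left, h]
  induction y using TensorProduct.induction_on with
  | zero => simp
  | add x y hx hy => simp only [map_add, smul_add, hx, hy]
  | tmul p q => simp [Lu_tmul, Gu_tmul]

theorem Lu_comul (R : A ⊗[K] A) (hR3 : ∀ x : A, R * ΔΔ x = TensorProduct.comm K A A (ΔΔ x) * R) (x : A) :
    Lu (Gu K A R) (ΔΔ x) = εε x • Gu K A R := by
  rw [← Gu_mul_left, hR3, Gu_mul_right _ _ (εε x)]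
  have : ∀ s : A ⊗[K] A, Gu K A (TensorProduct.comm K A A s) = LinearMap.mul' K A (LinearMap.rTensor A SS s) := by
    intro s
    induction s using TensorProduct.induction_on with
    | zero => simp
    | add x y hx hy => simp only [map_add, hx, hy]
    | tmul p q => simp [Gu_tmul]
  rw [this, HopfAlgebra.mul_antipode_rTensor_comul_apply, Algebra.algebraMap_eq_smul_one]

theorem S2_u (R : A ⊗[K] A) (hR3 : ∀ x : A, R * ΔΔ x = TensorProduct.comm K A A (ΔΔ x) * R) (x : A) :
    SS (SS x) * Gu K A R = Gu K A R * x := by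
  set u := Gu K A R with hu
  let Φ : A ⊗[K] (A ⊗[K] A) →ₗ[K] A :=
    TensorProduct.lift ((LinearMap.mul K A ∘ₗ LinearMap.mulRight K u ∘ₗ SS ∘ₗ LinearMap.mul' K A ∘ₗ
      LinearMap.lTensor A SS).flip)
  have hΦ : ∀ p q r, Φ (p ⊗ₜ (q ⊗ₜ r)) = SS (q * SS r) * u * p := by
    intro p q r; simp [Φ]
  have h := sw Φ (LinearMap.mulRight K u ∘ₗ SS ∘ₗ SS ∘ₗ (TensorProduct.lid K A).toLinearMap ∘ₗ LinearMap.rTensor A εε)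
    (LinearMap.mulLeft K u ∘ₗ (TensorProduct.rid K A).toLinearMap ∘ₗ LinearMap.lTensor A εε) ?_ ?_ x
  · simpa [Coalgebra.rTensor_counit_comul, Coalgebra.lTensor_counit_comul] using h
  · intro p q
    have : ∀ s : A ⊗[K] A, Φ (TensorProduct.assoc K A A A (s ⊗ₜ q)) = SS (SS q) * Lu u s := by
      intro s
      induction s using TensorProduct.induction_on with
      | zero => simp
      | add x y hx hy => simp only [map_add, add_tmul, mul_add, hx, hy]
      | tmul c d => rw [TensorProduct.assoc_tmul, hΦ, Lu_tmul, HopfAlgebra.antipode_mul_antidistrib]; simp only [mul_assoc]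
    rw [this, Lu_comul R hR3]
    simp [hu]
  · intro p q
    have : Φ (p ⊗ₜ ΔΔ q) = SS (LinearMap.mul' K A (LinearMap.lTensor A SS (ΔΔ q))) * u * p := by simp [Φ]
    rw [this, HopfAlgebra.mul_antipode_lTensor_comul_apply]
    simp [Algebra.algebraMap_eq_smul_one]

theorem comul_u (R : A ⊗[K] A) (hr1 : TensorProduct.assoc K A A A (LinearMap.rTensor A ΔΔ R) = i13 K A R * i23 K A R)
    (hr2' : LinearMap.lTensor A ΔΔ R = i13 K A R * i12 K A R)
    (hR3 : ∀ x : A, R * ΔΔ x = TensorProduct.comm K A A (ΔΔ x) * R)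
    (h4' : R * TensorProduct.comm K A A R = 1) (hss : TensorProduct.map SS SS R = R) :
    ΔΔ (Gu K A R) = Gu K A R ⊗ₜ Gu K A R := by
  have hS2 := S2_u R hR3
  obtain ⟨n, a, b, hR⟩ := TensorProduct.exists_sum_tmul_eq R
  have hu : Gu K A R = ∑ i, SS (b i) * a i := by rw [hR, map_sum]; simp only [Gu_tmul]
  set u := Gu K A R with hudef
  -- first form of coproduct
  have c1 : ∑ i, (ΔΔ (a i)) ⊗ₜ[K] b i = ∑ i, ∑ j, (a i ⊗ₜ[K] a j) ⊗ₜ[K] (b i * b j) := by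
    apply (TensorProduct.assoc K A A A).injective
    rw [hR] at hr1
    simp only [map_sum, Finset.sum_mul_sum, i13, i23, LinearMap.rTensor_tmul, LinearMap.lTensor_tmul, TensorProduct.mk_apply,
      Algebra.TensorProduct.tmul_mul_tmul, mul_one, one_mul] at hr1
    simp only [map_sum, hr1, TensorProduct.assoc_tmul]
  have c2 : ∑ i, a i ⊗ₜ[K] ΔΔ (b i) = ∑ i, ∑ j, (a i * a j) ⊗ₜ[K] (b j ⊗ₜ[K] b i) := by
    rw [hR] at hr2'
    simp only [map_sum, Finset.sum_mul_sum, i13, i12, LinearMap.lTensor_tmul, TensorProduct.mk_apply, LinearMap.flip_apply,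
      Algebra.TensorProduct.tmul_mul_tmul, mul_one, one_mul] at hr2'
    exact hr2'
  have c3 : ∑ i, SS (SS (a i)) ⊗ₜ[K] SS (b i) = ∑ i, SS (a i) ⊗ₜ[K] b i := by
    have := congrArg (LinearMap.rTensor A SS) hss
    rw [hR] at this
    simpa using this
  have c4 : ∑ i, ∑ j, (a i * b j) ⊗ₜ[K] (b i * a j) = 1 := by
    rw [hR] at h4'
    simpa only [map_sum, comm_tmul, Finset.sum_mul_sum, Algebra.TensorProduct.tmul_mul_tmul] using h4'
  -- step 0
  have s0 : ΔΔ u = ∑ i, ∑ j, (SS (b i) ⊗ₜ[K] SS (b j)) * (ΔΔ (a i) * ΔΔ (a j)) := by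
    let F : A ⊗[K] (A ⊗[K] A) →ₗ[K] A ⊗[K] A := TensorProduct.lift ((LinearMap.mul K (A ⊗[K] A) ∘ₗ TensorProduct.map SS SS ∘ₗ (TensorProduct.comm K A A).toLinearMap).flip ∘ₗ ΔΔ)
    have := congrArg F c2
    simp only [map_sum] at this
    rw [hu, map_sum]
    simpa [F, comul_antipode'] using this
  have s1 : ∀ d : A, ∑ i, (SS (b i) ⊗ₜ[K] SS d) * ΔΔ (a i) = ∑ j, (SS (b j) * u) ⊗ₜ[K] (SS d * a j) := by
    intro d
    let F : (A ⊗[K] A) ⊗[K] A →ₗ[K] A ⊗[K] A := TensorProduct.lift ((LinearMap.mul K (A ⊗[K] A) ∘ₗ (TensorProduct.mk K A A).flip (SS d) ∘ₗ SS).flip)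
    have := congrArg F c1
    simp only [map_sum, F, lift.tmul, LinearMap.flip_apply, LinearMap.comp_apply, LinearMap.mul_apply', TensorProduct.mk_apply,
      Algebra.TensorProduct.tmul_mul_tmul, HopfAlgebra.antipode_mul_antidistrib] at this
    rw [this, Finset.sum_comm]
    refine Finset.sum_congr rfl fun j _ => ?_
    rw [hu, Finset.mul_sum, TensorProduct.sum_tmul]
    simp only [mul_assoc]
  have s2 : ∀ p q : A, ∑ k, (p ⊗ₜ[K] (SS (b k) * q)) * ΔΔ (a k) = ∑ k, ∑ l, (p * a k) ⊗ₜ[K] (SS (b l) * SS (b k) * q * a l) := by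
    intro p q
    let F : (A ⊗[K] A) ⊗[K] A →ₗ[K] A ⊗[K] A := TensorProduct.lift ((LinearMap.mul K (A ⊗[K] A) ∘ₗ (TensorProduct.mk K A A) p ∘ₗ LinearMap.mulRight K q ∘ₗ SS).flip)
    have := congrArg F c1
    simp only [map_sum, F, lift.tmul, LinearMap.flip_apply, LinearMap.comp_apply, LinearMap.mul_apply', TensorProduct.mk_apply,
      Algebra.TensorProduct.tmul_mul_tmul, HopfAlgebra.antipode_mul_antidistrib, LinearMap.mulRight_apply] at this
    exact this
  have s3 : ∑ j, ∑ k, (SS (b j) * SS (SS (a k))) ⊗ₜ[K] (SS (b k) * a j) = 1 := by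
    have h1 : ∀ j, ∑ k, (SS (b j) * SS (SS (a k))) ⊗ₜ[K] (SS (b k) * a j) = ∑ k, (SS (b j) * SS (a k)) ⊗ₜ[K] (b k * a j) := by
      intro j
      have := congrArg (TensorProduct.map (LinearMap.mulLeft K (SS (b j))) (LinearMap.mulRight K (a j))) c3
      simpa using this
    simp only [h1]
    have := congrArg (LinearMap.rTensor A SS) c4
    simp only [map_sum, LinearMap.rTensor_tmul, HopfAlgebra.antipode_mul_antidistrib, Algebra.TensorProduct.one_def, HopfAlgebra.antipode_one] at this
    rw [Finset.sum_comm, this, Algebra.TensorProduct.one_def]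
  have s0' : ΔΔ u = ∑ j, ∑ k, ((SS (b j) * u) ⊗ₜ[K] (SS (b k) * a j)) * ΔΔ (a k) := by
    rw [s0, Finset.sum_comm]
    simp only [← mul_assoc, ← Finset.sum_mul, s1]
    rw [Finset.sum_comm]
    simp only [Finset.sum_mul]
  rw [s0']
  simp only [s2]
  calc ∑ j, ∑ k, ∑ l, (SS (b j) * u * a k) ⊗ₜ[K] (SS (b l) * SS (b k) * a j * a l)
      = ∑ l, (1 ⊗ₜ[K] SS (b l)) * (∑ j, ∑ k, (SS (b j) * SS (SS (a k))) ⊗ₜ[K] (SS (b k) * a j)) * (u ⊗ₜ[K] a l) := by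
        have : ∀ j, ∑ k, ∑ l, (SS (b j) * u * a k) ⊗ₜ[K] (SS (b l) * SS (b k) * a j * a l) =
          ∑ l, ∑ k, (SS (b j) * u * a k) ⊗ₜ[K] (SS (b l) * SS (b k) * a j * a l) := fun j => Finset.sum_comm
        simp only [this]
        rw [Finset.sum_comm]
        refine Finset.sum_congr rfl fun l _ => ?_
        simp only [Finset.mul_sum, Finset.sum_mul, Algebra.TensorProduct.tmul_mul_tmul, one_mul]
        refine Finset.sum_congr rfl fun j _ => Finset.sum_congr rfl fun k _ => ?_
        rw [mul_assoc (SS (b j)) u, ← hS2]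
        simp only [mul_assoc]
    _ = u ⊗ₜ u := by
        rw [s3]
        simp only [mul_one, Algebra.TensorProduct.tmul_mul_tmul, one_mul]
        rw [← TensorProduct.tmul_sum, ← hu]

theorem counit_u (R : A ⊗[K] A) (h : TensorProduct.lid K A (LinearMap.rTensor A εε R) = 1) :
    εε (Gu K A R) = 1 := by
  have e : ∀ x : A ⊗[K] A, εε (Gu K A x) = εε (TensorProduct.lid K A (LinearMap.rTensor A εε x)) := by
    intro x
    induction x using TensorProduct.induction_on with
    | zero => simp
    | add x y hx hy => simp only [map_add, hx, hy]
    | tmul p q => simp [Gu_tmul, mul_comm]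
  rw [e, h]; simp

theorem exists_u [FiniteDimensional K A] (R : A ⊗[K] A) (hr1 : TensorProduct.assoc K A A A (LinearMap.rTensor A ΔΔ R) = i13 K A R * i23 K A R)
    (hr2' : LinearMap.lTensor A ΔΔ R = i13 K A R * i12 K A R)
    (hR3 : ∀ x : A, R * ΔΔ x = TensorProduct.comm K A A (ΔΔ x) * R)
    (h4' : R * TensorProduct.comm K A A R = 1) :
    ∃ u : A, ∃ M : ℕ, 0 < M ∧ u ^ M = 1 ∧ εε u = 1 ∧ ∀ x, SS (SS x) * u = u * x := by
  have hg : IsGroupLikeElem K (Gu K A R) :=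
    ⟨counit_u R (eps_R R hr1 h4'), comul_u R hr1 hr2' hR3 h4' (SS_R R (S_R R hr1 h4'))⟩
  have hfin : Finite (GroupLike K A) := (linearIndep_groupLikeVal (R := K) (A := A)).finite
  obtain ⟨M, hM, h⟩ := (isOfFinOrder_iff_pow_eq_one.1 (isOfFinOrder_of_finite (⟨_, hg⟩ : GroupLike K A)))
  refine ⟨Gu K A R, M, hM, ?_, hg.counit_eq_one, S2_u R hR3⟩
  exact congrArg GroupLike.val h
end base11

section base12
universe v
variable {K : Type*} {A : Type v} [Field K] [Ring A] [HopfAlgebra K A] 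

local notation "SS" => HopfAlgebra.antipode K (A := A)
local notation "ΔΔ" => Coalgebra.comul (R := K) (A := A)
local notation "εε" => Coalgebra.counit (R := K) (A := A)

theorem exists_integral [IsSemisimpleRing A] (Sinv : A →ₗ[K] A) (hS2 : ∀ x, SS (Sinv x) = x) :
    ∃ Λ : A, εε Λ = 1 ∧ ∀ x, Λ * x = εε x • Λ := by
  let I : Ideal A := RingHom.ker (Bialgebra.counitAlgHom K A)
  obtain ⟨e, he, hI⟩ := IsSemisimpleRing.ideal_eq_span_idempotent I
  have hmem : ∀ x : A, εε x = 0 → x * (1 - e) = 0 := by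
    intro x hx
    have : x ∈ I := by rw [RingHom.mem_ker]; exact hx
    rw [hI, Ideal.mem_span_singleton'] at this
    obtain ⟨y, rfl⟩ := this
    rw [mul_sub, mul_one, mul_assoc, he, sub_self]
  have he0 : εε e = 0 := by
    have : e ∈ I := by rw [hI]; exact Ideal.mem_span_singleton_self e
    have h2 : Bialgebra.counitAlgHom K A e = 0 := RingHom.mem_ker.1 this
    exact h2
  have hL : ∀ x : A, x * (1 - e) = εε x • (1 - e) := by
    intro x
    have := hmem (x - εε x • 1) (by simp)
    rw [sub_mul, sub_eq_zero] at this
    rw [this]; simp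
  refine ⟨SS (1 - e), by simp [he0], fun x => ?_⟩
  have h := congrArg SS (hL (Sinv x))
  rw [HopfAlgebra.antipode_mul_antidistrib, hS2, map_smul, ← HopfAlgebra.counit_antipode, hS2] at h
  exact h

theorem Sinv_mul (Sinv : A →ₗ[K] A) (hS1 : ∀ x, Sinv (SS x) = x) (hS2 : ∀ x, SS (Sinv x) = x) (x y : A) :
    Sinv (x * y) = Sinv y * Sinv x := by
  have : Function.Injective SS := Function.LeftInverse.injective hS1
  apply this
  rw [hS2, HopfAlgebra.antipode_mul_antidistrib, hS2, hS2]

theorem Sinv_comul (Sinv : A →ₗ[K] A) (hS1 : ∀ x, Sinv (SS x) = x) (hS2 : ∀ x, SS (Sinv x) = x) (x : A) :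
    ΔΔ (Sinv x) = TensorProduct.map Sinv Sinv (TensorProduct.comm K A A (ΔΔ x)) := by
  have h := comul_antipode' (K := K) (Sinv x)
  rw [hS2] at h
  rw [h]
  generalize ΔΔ (Sinv x) = s
  induction s using TensorProduct.induction_on with
  | zero => simp
  | add x y hx hy => rw [map_add, map_add, map_add, map_add, ← hx, ← hy]
  | tmul a b => simp [hS1]

theorem Sinv2_comul (Sinv : A →ₗ[K] A) (hS1 : ∀ x, Sinv (SS x) = x) (hS2 : ∀ x, SS (Sinv x) = x) (x : A) :
    ΔΔ (Sinv (Sinv x)) = TensorProduct.map (Sinv ∘ₗ Sinv) (Sinv ∘ₗ Sinv) (ΔΔ x) := by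
  rw [Sinv_comul Sinv hS1 hS2, Sinv_comul Sinv hS1 hS2]
  generalize ΔΔ x = s
  induction s using TensorProduct.induction_on with
  | zero => simp
  | add x y hx hy => simp only [map_add, hx, hy]
  | tmul a b => simp

def Zt (σ : A →ₗ[K] A) (f : A →ₗ[K] K) : A ⊗[K] A →ₗ[K] A :=
  (TensorProduct.rid K A).toLinearMap ∘ₗ TensorProduct.map σ f

theorem Zt_tmul (σ : A →ₗ[K] A) (f : A →ₗ[K] K) (p q : A) : Zt σ f (p ⊗ₜ q) = f q • σ p := by simp [Zt]

def Zm (σ : A →ₗ[K] A) (f : A →ₗ[K] K) : Module.End K A := Zt σ f ∘ₗ ΔΔ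

def Wm (Sinv : A →ₗ[K] A) (Z : Module.End K A) : A ⊗[K] A →ₗ[K] Module.End K A :=
  TensorProduct.lift ((LinearMap.mul K (Module.End K A)).compl₁₂ (LinearMap.mul K A ∘ₗ Sinv)
    (LinearMap.mulLeft K Z ∘ₗ LinearMap.mul K A))

theorem Wm_tmul (Sinv : A →ₗ[K] A) (Z : Module.End K A) (p q : A) :
    Wm Sinv Z (p ⊗ₜ q) = LinearMap.mulLeft K (Sinv p) * (Z * LinearMap.mulLeft K q) := by
  simp only [Wm, lift.tmul, LinearMap.compl₁₂_apply, LinearMap.comp_apply, LinearMap.mul_apply', LinearMap.mulLeft_apply]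
  rfl

theorem Wm_comul (Sinv : A →ₗ[K] A) (hS1 : ∀ x, Sinv (SS x) = x) (hS2 : ∀ x, SS (Sinv x) = x) (f : A →ₗ[K] K) (h : A) :
    Wm Sinv (Zm (Sinv ∘ₗ Sinv) f) (ΔΔ h) = Zm (Sinv ∘ₗ Sinv) (f ∘ₗ LinearMap.mulLeft K h) := by
  set σ := Sinv ∘ₗ Sinv with hσ
  have hσm : ∀ x y, σ (x * y) = σ x * σ y := by
    intro x y; simp only [hσ, LinearMap.comp_apply, Sinv_mul Sinv hS1 hS2]
  refine LinearMap.ext fun x => ?_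
  let s := ΔΔ x
  let Φ : A ⊗[K] (A ⊗[K] A) →ₗ[K] A :=
    TensorProduct.lift ((LinearMap.mul K A).compl₁₂ Sinv (Zt σ f ∘ₗ LinearMap.mulRight K s))
  have hΦ : ∀ p t, Φ (p ⊗ₜ t) = Sinv p * Zt σ f (t * s) := by intro p t; simp [Φ]
  have key := sw Φ (Zt σ f ∘ₗ LinearMap.mulRight K s ∘ₗ LinearMap.rTensor A (Algebra.linearMap K A ∘ₗ εε))
    ((LinearMap.applyₗ x) ∘ₗ Wm Sinv (Zm σ f)) ?_ ?_ h
  · rw [LinearMap.comp_apply, LinearMap.comp_apply, LinearMap.comp_apply, LinearMap.rTensor_comp, LinearMap.comp_apply,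
      Coalgebra.rTensor_counit_comul] at key
    rw [LinearMap.applyₗ_apply_apply] at key
    rw [← key]
    have : ∀ s : A ⊗[K] A, Zt σ f ((1 ⊗ₜ h) * s) = Zt σ (f ∘ₗ LinearMap.mulLeft K h) s := by
      intro s
      induction s using TensorProduct.induction_on with
      | zero => simp
      | add x y hx hy => simp only [map_add, mul_add, hx, hy]
      | tmul a b => simp [Zt_tmul]
    simpa [Zm] using this s
  · intro p q
    have : ∀ t s : A ⊗[K] A, TensorProduct.lift ((LinearMap.mul K A).compl₁₂ Sinv (Zt σ f ∘ₗ LinearMap.mulRight K s)) (TensorProduct.assoc K A A A (t ⊗ₜ q)) =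
        Zt σ f (((LinearMap.mul' K A (LinearMap.rTensor A SS t)) ⊗ₜ q) * s) := by
      intro t s
      induction t using TensorProduct.induction_on with
      | zero => simp
      | add x y hx hy => simp only [map_add, add_tmul, add_mul, hx, hy]
      | tmul a b =>
        induction s using TensorProduct.induction_on with
        | zero => simp
        | add x y hx hy =>
          simp only [TensorProduct.assoc_tmul, lift.tmul, LinearMap.compl₁₂_apply, LinearMap.comp_apply, LinearMap.mulRight_apply,
            mul_add, map_add, LinearMap.mul_apply'] at hx hy ⊢
          rw [hx, hy]
        | tmul c d => 
          have : σ (SS a) = Sinv a := by simp [hσ, hS1]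
          simp [Zt_tmul, hσm, this, mul_assoc]
    rw [this (ΔΔ p) s, HopfAlgebra.mul_antipode_rTensor_comul_apply]
    simp
  · intro p q
    rw [hΦ, LinearMap.comp_apply, Wm_tmul, LinearMap.applyₗ_apply_apply]
    simp [Zm, s]

theorem trace_Wm [FiniteDimensional K A] (Sinv : A →ₗ[K] A) (hS1 : ∀ x, Sinv (SS x) = x) (hS2 : ∀ x, SS (Sinv x) = x)
    (Z : Module.End K A) (h : A) :
    LinearMap.trace K A (Wm Sinv Z (ΔΔ h)) = εε h * LinearMap.trace K A Z := by
  have e1 : ∀ t : A ⊗[K] A, LinearMap.trace K A (Wm Sinv Z t) =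
      LinearMap.trace K A (Z * LinearMap.mulLeft K (Sinv (LinearMap.mul' K A (LinearMap.lTensor A SS t)))) := by
    intro t
    induction t using TensorProduct.induction_on with
    | zero => simp [LinearMap.mulLeft_zero_eq_zero]
    | add x y hx hy =>
      have mLa' : ∀ x y : A, LinearMap.mulLeft K (x + y) = LinearMap.mulLeft K x + LinearMap.mulLeft K y :=
        fun x y => LinearMap.ext fun w => add_mul x y w
      simp only [map_add, mLa', mul_add, hx, hy]
    | tmul p q =>
      rw [Wm_tmul, LinearMap.trace_mul_comm, mul_assoc]
      simp only [LinearMap.lTensor_tmul, LinearMap.mul'_apply, Sinv_mul Sinv hS1 hS2, hS1]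
      rw [LinearMap.mulLeft_mul]; rfl
  rw [e1, HopfAlgebra.mul_antipode_lTensor_comul_apply]
  have : Sinv 1 = 1 := by rw [← HopfAlgebra.antipode_one (R := K) (A := A), hS1, HopfAlgebra.antipode_one]
  rw [Algebra.algebraMap_eq_smul_one, map_smul, this]
  have h2 : LinearMap.mulLeft K (εε h • (1 : A)) = εε h • (1 : Module.End K A) := by
    ext; simp
  rw [h2, mul_smul_comm, mul_one, map_smul, smul_eq_mul]

def rr (K A : Type*) [Field K] [Ring A] [Algebra K A] : A →ₗ[K] K :=
  LinearMap.trace K A ∘ₗ LinearMap.mul K A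

theorem rr_apply (x : A) : rr K A x = LinearMap.trace K A (LinearMap.mulLeft K x) := rfl

theorem rr_conv [FiniteDimensional K A] (x : A) :
    LinearMap.mul' K K (TensorProduct.map (rr K A) (rr K A) (ΔΔ x)) = (Module.finrank K A : K) * rr K A x := by
  have e1 : ∀ t : A ⊗[K] A, LinearMap.mul' K K (TensorProduct.map (rr K A) (rr K A) t) =
      LinearMap.trace K _ (LinearMap.mulLeft K t) := by
    intro t
    induction t using TensorProduct.induction_on with
    | zero => simp [LinearMap.mulLeft_zero_eq_zero]
    | add x y hx hy =>
      have mLa : ∀ x y : A ⊗[K] A, LinearMap.mulLeft K (x + y) = LinearMap.mulLeft K x + LinearMap.mulLeft K y :=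
        fun x y => LinearMap.ext fun w => add_mul x y w
      simp only [map_add, mLa, hx, hy]
    | tmul p q =>
      have : LinearMap.mulLeft K (p ⊗ₜ[K] q) = TensorProduct.map (LinearMap.mulLeft K p) (LinearMap.mulLeft K q) := by
        ext; simp
      rw [this, LinearMap.trace_tensorProduct']
      simp [rr_apply]
  rw [e1]
  have e2 : (LinearMap.mulLeft K (ΔΔ x) : Module.End K (A ⊗[K] A)) * Th0 K A = Th0 K A * LinearMap.rTensor A (LinearMap.mulLeft K x) := by
    refine TensorProduct.ext' fun y v => ?_
    simp [Th0_tmul, Bialgebra.comul_mul, mul_assoc]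
  have e3 : (LinearMap.mulLeft K (ΔΔ x) : Module.End K (A ⊗[K] A)) = Th0 K A * LinearMap.rTensor A (LinearMap.mulLeft K x) * Ti0 K A := by
    rw [← e2, mul_assoc, Th0_Ti0, mul_one]
  have h : Ti0 K A * Th0 K A = 1 := mul_eq_one_comm.1 Th0_Ti0
  rw [e3, LinearMap.trace_mul_comm, ← mul_assoc, h, one_mul, LinearMap.rTensor, LinearMap.trace_tensorProduct', LinearMap.trace_id, rr_apply, mul_comm]

theorem traceData [CharZero K] [FiniteDimensional K A] [IsSemisimpleRing A] (Sinv : A →ₗ[K] A) (hS1 : ∀ x, Sinv (SS x) = x) (hS2 : ∀ x, SS (Sinv x) = x)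
    (u v : A) (huv : u * v = 1) (hσ : ∀ x, Sinv (Sinv x) = v * x * u) (M : ℕ) (huM : u ^ M = 1) (hvM : v ^ M = 1) :
    ((Sinv ∘ₗ Sinv : Module.End K A) ^ M = 1) ∧ ∃ B : Module.End K A, B ^ (M+1) = B ∧
      (Module.finrank K A : K) * LinearMap.trace K A B = LinearMap.trace K A (Sinv ∘ₗ Sinv) := by
  have hnt : Nontrivial A := by
    refine ⟨0, 1, fun h01 => ?_⟩
    have := congrArg (Coalgebra.counit (R := K)) h01
    simp at this
  have hN0 : (Module.finrank K A : K) ≠ 0 := by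
    have : 0 < Module.finrank K A := Module.finrank_pos
    exact_mod_cast this.ne'
  set N : K := (Module.finrank K A : K)
  set σ : Module.End K A := Sinv ∘ₗ Sinv with hσd
  have hσM : σ ^ M = 1 := by
    have : ∀ n : ℕ, ∀ x, (σ ^ n) x = v ^ n * x * u ^ n := by
      intro n
      induction n with
      | zero => simp
      | succ n ih =>
        intro x
        rw [pow_succ', Module.End.mul_apply, ih]
        simp only [hσd, LinearMap.comp_apply, hσ, pow_succ' v, pow_succ u, mul_assoc]
    ext x
    rw [this, huM, hvM]; simp
  refine ⟨hσM, ?_⟩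
  let E' : Module.End K A := Zm LinearMap.id (rr K A)
  have hE2 : E' * E' = N • E' := by
    refine LinearMap.ext fun x => ?_
    have := sw (K := K) (A := A) ((TensorProduct.rid K A).toLinearMap ∘ₗ LinearMap.lTensor A (LinearMap.mul' K K ∘ₗ TensorProduct.map (rr K A) (rr K A)))
      (Zt E' (rr K A)) (N • Zt LinearMap.id (rr K A)) ?_ ?_ x
    · have h3 : ∀ s : A ⊗[K] A, E' (Zt LinearMap.id (rr K A) s) = Zt E' (rr K A) s := by
        intro s
        induction s using TensorProduct.induction_on with
        | zero => simp
        | add x y hx hy => simp only [map_add, hx, hy]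
        | tmul a b => simp [Zt_tmul]
      exact (h3 _).trans this
    · intro p q
      rw [Zt_tmul]
      change rr K A q • Zt LinearMap.id (rr K A) (ΔΔ p) = _
      generalize ΔΔ p = s
      induction s using TensorProduct.induction_on with
      | zero => simp
      | add x y hx hy => simp only [map_add, smul_add, add_tmul, hx, hy]
      | tmul a b => simp [Zt_tmul, smul_smul, mul_comm]
    · intro p q
      rw [LinearMap.comp_apply, LinearMap.lTensor_tmul, LinearMap.comp_apply, rr_conv]
      simp [Zt_tmul, smul_smul, N]
  have hrσ : ∀ x, rr K A (σ x) = rr K A x := by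
    intro x
    simp only [hσd, LinearMap.comp_apply, hσ, rr_apply]
    have : LinearMap.mulLeft K (v * x * u) = (LinearMap.mulLeft K v * LinearMap.mulLeft K x * LinearMap.mulLeft K u : Module.End K A) := by
      rw [LinearMap.mulLeft_mul, LinearMap.mulLeft_mul]; rfl
    rw [this, LinearMap.trace_mul_comm, ← mul_assoc]
    have h2 : (LinearMap.mulLeft K u * LinearMap.mulLeft K v : Module.End K A) = 1 := by
      rw [Module.End.mul_eq_comp, ← LinearMap.mulLeft_mul, huv, LinearMap.mulLeft_one]; rfl
    rw [h2, one_mul]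
  have hσE : Commute σ E' := by
    refine LinearMap.ext fun x => ?_
    change σ (Zt LinearMap.id (rr K A) (ΔΔ x)) = Zt LinearMap.id (rr K A) (ΔΔ (Sinv (Sinv x)))
    rw [Sinv2_comul Sinv hS1 hS2]
    generalize ΔΔ x = s
    induction s using TensorProduct.induction_on with
    | zero => simp
    | add x y hx hy => simp only [map_add, hx, hy]
    | tmul a b => simp [Zt_tmul, ← hσd, hrσ]
  have hZr : Zm σ (rr K A) = σ * E' := by
    refine LinearMap.ext fun x => ?_
    change Zt σ (rr K A) (ΔΔ x) = σ (Zt LinearMap.id (rr K A) (ΔΔ x))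
    generalize ΔΔ x = s
    induction s using TensorProduct.induction_on with
    | zero => simp
    | add x y hx hy => simp only [map_add, hx, hy]
    | tmul a b => simp [Zt_tmul]
  have hZε : Zm σ εε = σ := by
    refine LinearMap.ext fun x => ?_
    have h3 : ∀ s : A ⊗[K] A, Zt σ εε s = σ (TensorProduct.rid K A (LinearMap.lTensor A εε s)) := by
      intro s
      induction s using TensorProduct.induction_on with
      | zero => simp
      | add x y hx hy => simp only [map_add, hx, hy]
      | tmul a b => simp [Zt_tmul]
    refine (h3 _).trans ?_
    rw [Coalgebra.lTensor_counit_comul]; simp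
  obtain ⟨Λ, hΛ1, hΛ⟩ := exists_integral Sinv hS2
  have hrΛ : rr K A ∘ₗ LinearMap.mulLeft K Λ = εε := by
    have h1 : rr K A Λ = 1 := by
      have : LinearMap.mulLeft K Λ = LinearMap.smulRight εε Λ := by ext x; simp [hΛ]
      rw [rr_apply, this, LinearMap.trace_smulRight, hΛ1]
    ext x
    rw [LinearMap.comp_apply, LinearMap.mulLeft_apply, hΛ, map_smul, h1]; simp
  have hmain := trace_Wm Sinv hS1 hS2 (Zm σ (rr K A)) Λ
  rw [Wm_comul Sinv hS1 hS2, hrΛ, ← hσd, hZε, hΛ1, one_mul, hZr] at hmain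
  have hEpow : ∀ n : ℕ, (N⁻¹ • E') ^ (n+1) = N⁻¹ • E' := by
    intro n
    induction n with
    | zero => simp
    | succ n ih =>
      rw [pow_succ, ih, smul_mul_smul_comm, hE2, smul_smul, mul_assoc, inv_mul_cancel₀ hN0, mul_one]
  refine ⟨σ * (N⁻¹ • E'), ?_, ?_⟩
  · have hc : Commute σ (N⁻¹ • E') := hσE.smul_right _
    rw [hc.mul_pow, hEpow, pow_succ, hσM, one_mul]
  · rw [mul_smul_comm, map_smul, smul_eq_mul, ← mul_assoc, mul_inv_cancel₀ hN0, one_mul, hmain]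
end base12

section base13

theorem exists_eigbasis {F V : Type*} [Field F] [CharZero F] [IsAlgClosed F] [AddCommGroup V] [Module F V]
    [FiniteDimensional F V] (f : Module.End F V) (M : ℕ) (hM : 0 < M) (hf : f ^ (M+1) = f) :
    ∃ (b : Module.Basis (Fin (Module.finrank F V)) F V) (c : Fin (Module.finrank F V) → F),
      (∀ i, f (b i) = c i • b i) ∧ ∀ i, c i ^ (M+1) = c i := by
  have hsq : Squarefree (Polynomial.X ^ (M+1) - Polynomial.X : Polynomial F) := by
    have h1 : (Polynomial.X ^ (M+1) - Polynomial.X : Polynomial F) = Polynomial.X * (Polynomial.X ^ M - Polynomial.C 1) := by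
      rw [mul_sub, pow_succ', Polynomial.C_1, mul_one]
    rw [h1]
    have h2 : (Polynomial.X ^ M - Polynomial.C 1 : Polynomial F).Separable :=
      Polynomial.separable_X_pow_sub_C 1 (by exact_mod_cast hM.ne') one_ne_zero
    refine (Polynomial.Separable.mul Polynomial.separable_X h2 ?_).squarefree
    refine ⟨Polynomial.X ^ (M-1), -1, ?_⟩
    obtain ⟨m, rfl⟩ : ∃ m, M = m+1 := ⟨M-1, by omega⟩
    simp [pow_succ]
  have hss : f.IsSemisimple := by
    refine Module.End.isSemisimple_of_squarefree_aeval_eq_zero hsq ?_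
    simp [hf]
  have htop := hss.iSup_eigenspace_eq_top
  classical
  have hint : DirectSum.IsInternal (fun μ : F => f.eigenspace μ) :=
    (DirectSum.isInternal_submodule_iff_iSupIndep_and_iSup_eq_top _).2 ⟨Module.End.eigenspaces_iSupIndep f, htop⟩
  let b0 := hint.collectedBasis (fun μ => Module.Free.chooseBasis F (f.eigenspace μ))
  have : Finite (Σ μ : F, Module.Free.ChooseBasisIndex F (f.eigenspace μ)) := Module.Finite.finite_basis b0
  have := Fintype.ofFinite (Σ μ : F, Module.Free.ChooseBasisIndex F (f.eigenspace μ))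
  let e := Fintype.equivFinOfCardEq (Module.finrank_eq_card_basis b0).symm
  have hb : ∀ i, f (b0.reindex e i) = (e.symm i).1 • b0.reindex e i := by
    intro i
    rw [Module.Basis.reindex_apply]
    exact Module.End.mem_eigenspace_iff.1 (hint.collectedBasis_mem _ _)
  refine ⟨b0.reindex e, fun i => (e.symm i).1, hb, fun i => ?_⟩
  have hp : ∀ n : ℕ, (f ^ n) (b0.reindex e i) = (e.symm i).1 ^ n • b0.reindex e i := by
    intro n
    induction n with
    | zero => simp
    | succ n ih => rw [pow_succ, Module.End.mul_apply, hb, map_smul, ih, smul_smul, pow_succ, mul_comm]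
  have h := hp (M+1)
  rw [hf, hb] at h
  exact (smul_left_injective F ((b0.reindex e).ne_zero i) h).symm

theorem eig_pow {F V ι : Type*} [Field F] [AddCommGroup V] [Module F V] (f : Module.End F V)
    (b : Module.Basis ι F V) (c : ι → F) (hb : ∀ i, f (b i) = c i • b i) (n : ℕ) (i : ι) :
    (f ^ n) (b i) = c i ^ n • b i := by
  induction n with
  | zero => simp
  | succ n ih => rw [pow_succ, Module.End.mul_apply, hb, map_smul, ih, smul_smul, pow_succ, mul_comm]

theorem eig_trace {F V ι : Type*} [Fintype ι] [Field F] [AddCommGroup V] [Module F V] (f : Module.End F V)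
    (b : Module.Basis ι F V) (c : ι → F) (hb : ∀ i, f (b i) = c i • b i) :
    LinearMap.trace F V f = ∑ i, c i := by
  classical
  rw [LinearMap.trace_eq_matrix_trace F b, Matrix.trace]
  refine Finset.sum_congr rfl fun i _ => ?_
  rw [Matrix.diag_apply, LinearMap.toMatrix_apply, hb]
  simp

theorem cplx_unit (N : ℕ) (Z : ℂ) (hZ : ‖Z‖ = 1) (z : Fin N → ℂ) (hz : ∀ i, ‖z i‖ = 1)
    (h : (N:ℂ) * Z = ∑ i, z i) (i : Fin N) : z i = Z := by
  have hcZ : (starRingEnd ℂ) Z * Z = 1 := by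
    rw [mul_comm, Complex.mul_conj, Complex.normSq_eq_norm_sq, hZ]; simp
  have hn : ∀ i, ‖(starRingEnd ℂ) Z * z i‖ = 1 := fun i => by simp [hZ, hz]
  have hre : ∀ i, ((starRingEnd ℂ) Z * z i).re ≤ 1 := fun i => (hn i) ▸ Complex.re_le_norm _
  have hs : ∑ i, ((starRingEnd ℂ) Z * z i).re = ∑ i : Fin N, (1:ℝ) := by
    rw [← Complex.re_sum, ← Finset.mul_sum, ← h, mul_left_comm, hcZ]
    simp
  have h1 := (Finset.sum_eq_sum_iff_of_le (fun i _ => hre i)).1 hs i (Finset.mem_univ i)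
  have h2 : (starRingEnd ℂ) Z * z i = 1 := by
    have := Complex.re_eq_norm.1 (h1.trans (hn i).symm)
    apply Complex.ext
    · simpa using h1
    · simpa using (Complex.nonneg_iff.1 this).2.symm
  calc z i = Z * ((starRingEnd ℂ) Z * z i) := by rw [← mul_assoc, mul_comm Z, hcZ, one_mul]
    _ = Z := by rw [h2, mul_one]

theorem arith_core {F : Type*} [Field F] [CharZero F] (N M : ℕ) (hM : 0 < M) (hN : 0 < N)
    (c s : Fin N → F) (hc : ∀ i, c i ^ (M+1) = c i) (hs : ∀ i, s i ^ M = 1)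
    (h : (N : F) * ∑ i, c i = ∑ i, s i) (h0 : ∑ i, s i ≠ 0) (i0 : Fin N) (hi0 : s i0 = 1) (i : Fin N) :
    s i = 1 := by
  have hcI : ∀ i, IsIntegral ℤ (c i) := fun i =>
    ⟨Polynomial.X ^ (M+1) - Polynomial.X, by
      refine Polynomial.monic_X_pow_sub (by rw [Polynomial.degree_X]; exact_mod_cast (by omega : 1 < M+1)), by simp [hc i]⟩
  have hsI : ∀ i, IsIntegral ℤ (s i) := fun i =>
    ⟨Polynomial.X ^ M - 1, by
      exact Polynomial.monic_X_pow_sub_C 1 hM.ne', by simp [hs i]⟩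
  let T : Set F := Set.range c ∪ Set.range s
  let E := IntermediateField.adjoin ℚ T
  have : Finite T := by
    refine Set.Finite.union (Set.finite_range c) (Set.finite_range s)
  have : FiniteDimensional ℚ E := by
    refine IntermediateField.finiteDimensional_adjoin ?_
    rintro x (⟨i, rfl⟩ | ⟨i, rfl⟩)
    · exact (hcI i).tower_top
    · exact (hsI i).tower_top
  have : NumberField E := { to_charZero := inferInstance, to_finiteDimensional := inferInstance }
  let c' : Fin N → E := fun i => ⟨c i, IntermediateField.subset_adjoin ℚ T (Or.inl ⟨i, rfl⟩)⟩
  let s' : Fin N → E := fun i => ⟨s i, IntermediateField.subset_adjoin ℚ T (Or.inr ⟨i, rfl⟩)⟩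
  have hinj : Function.Injective (algebraMap E F) := (algebraMap E F).injective
  have hcc : ∀ i, algebraMap E F (c' i) = c i := fun i => rfl
  have hss : ∀ i, algebraMap E F (s' i) = s i := fun i => rfl
  have h' : (N : E) * ∑ i, c' i = ∑ i, s' i := by
    apply hinj; simp only [map_mul, map_natCast, map_sum, hcc, hss, h]
  have hs' : ∀ i, s' i ^ M = 1 := fun i => by apply hinj; rw [map_pow, hss, hs, map_one]
  have hint : IsIntegral ℤ (∑ i, c' i) := by
    refine IsIntegral.sum _ fun i _ => ?_
    refine ⟨Polynomial.X ^ (M+1) - Polynomial.X, ?_, ?_⟩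
    · refine Polynomial.monic_X_pow_sub (by rw [Polynomial.degree_X]; exact_mod_cast (by omega : 1 < M+1))
    · apply hinj; simpa [sub_eq_zero] using hc i
  have hne : ∑ i, c' i ≠ 0 := by
    intro h2
    rw [h2, mul_zero] at h'
    apply h0
    rw [← map_zero (algebraMap E F), h', map_sum]; rfl
  have hnz : ∀ (φ : E →+* ℂ) i, ‖φ (s' i)‖ = 1 := by
    intro φ i
    have : φ (s' i) ^ M = 1 := by rw [← map_pow, hs', map_one]
    exact Complex.norm_eq_one_of_pow_eq_one this hM.ne'
  have hle : ∀ φ : E →+* ℂ, ‖φ (∑ i, c' i)‖ ≤ 1 := by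
    intro φ
    have h3 : ‖φ ((N : E) * ∑ i, c' i)‖ ≤ N := by
      rw [h', map_sum]
      refine (norm_sum_le _ _).trans ?_
      simp [hnz]
    rw [map_mul, map_natCast, norm_mul, Complex.norm_natCast] at h3
    have hNp : (0:ℝ) < N := by exact_mod_cast hN
    nlinarith
  obtain ⟨n, hn, hn1⟩ := NumberField.Embeddings.pow_eq_one_of_norm_le_one E ℂ hne hint hle
  obtain ⟨φ⟩ : Nonempty (E →+* ℂ) := ⟨(IsAlgClosed.lift (R := ℚ) : E →ₐ[ℚ] ℂ).toRingHom⟩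
  have hZ : ‖φ (∑ i, c' i)‖ = 1 := by
    have : φ (∑ i, c' i) ^ n = 1 := by rw [← map_pow, hn1, map_one]
    exact Complex.norm_eq_one_of_pow_eq_one this hn.ne'
  have hu := cplx_unit N (φ (∑ i, c' i)) hZ (fun i => φ (s' i)) (hnz φ) (by
    rw [← map_natCast φ, ← map_mul, h', map_sum])
  have h5 : s' i = s' i0 := φ.injective ((hu i).trans (hu i0).symm)
  rw [← hi0, ← hss, h5, hss]

theorem arith_F {F V : Type*} [Field F] [CharZero F] [IsAlgClosed F] [AddCommGroup V] [Module F V]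
    [FiniteDimensional F V] (σ B : Module.End F V) (M : ℕ) (hM : 0 < M) (hσ : σ ^ M = 1)
    (hB : B ^ (M+1) = B) (h : (Module.finrank F V : F) * LinearMap.trace F V B = LinearMap.trace F V σ)
    (h0 : LinearMap.trace F V σ ≠ 0) (w : V) (hw : w ≠ 0) (hσw : σ w = w) : σ = 1 := by
  obtain ⟨b, c, hb, hc⟩ := exists_eigbasis B M hM hB
  obtain ⟨d, s, hd, hs⟩ := exists_eigbasis σ M hM (by rw [pow_succ, hσ, one_mul])
  have hs1 : ∀ i, s i ^ M = 1 := by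
    intro i
    have h1 := eig_pow σ d s hd M i
    rw [hσ, Module.End.one_apply] at h1
    refine (smul_left_injective F (d.ne_zero i) ?_)
    simpa using h1.symm
  rw [eig_trace B b c hb, eig_trace σ d s hd] at h
  rw [eig_trace σ d s hd] at h0
  obtain ⟨i0, hi0⟩ : ∃ i, d.repr w i ≠ 0 := by
    by_contra hcon
    push Not at hcon
    apply hw
    apply d.repr.injective
    ext i; simp [hcon]
  have hsi0 : s i0 = 1 := by
    have h1 : ∀ x, d.repr (σ x) i0 = s i0 * d.repr x i0 := by
      intro x
      have : (Finsupp.lapply i0 ∘ₗ d.repr.toLinearMap) ∘ₗ σ = s i0 • (Finsupp.lapply i0 ∘ₗ d.repr.toLinearMap) := by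
        refine d.ext fun j => ?_
        by_cases hj : j = i0
        · subst hj; simp [hd]
        · simp [hd, hj]
      exact LinearMap.congr_fun this x
    have h2 := h1 w
    rw [hσw] at h2
    exact (mul_right_cancel₀ hi0 (by rw [one_mul]; exact h2)).symm
  have hN : 0 < Module.finrank F V := i0.pos
  refine d.ext fun i => ?_
  rw [hd, arith_core _ M hM hN c s hc hs1 h h0 i0 hsi0 i]; simp

theorem arith_K {F V : Type*} [Field F] [CharZero F] [AddCommGroup V] [Module F V]
    [FiniteDimensional F V] (σ B : Module.End F V) (M : ℕ) (hM : 0 < M) (hσ : σ ^ M = 1)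
    (hB : B ^ (M+1) = B) (h : (Module.finrank F V : F) * LinearMap.trace F V B = LinearMap.trace F V σ)
    (h0 : LinearMap.trace F V σ ≠ 0) (w : V) (hw : w ≠ 0) (hσw : σ w = w) : σ = 1 := by
  let L := AlgebraicClosure F
  have : CharZero L := charZero_of_injective_algebraMap (algebraMap F L).injective
  have key := arith_F (F := L) (V := L ⊗[F] V) (σ.baseChange L) (B.baseChange L) M hM
    (by rw [← LinearMap.baseChange_pow, hσ]; exact LinearMap.baseChange_one _ _) (by rw [← LinearMap.baseChange_pow, hB])
    (by rw [LinearMap.trace_baseChange, LinearMap.trace_baseChange, ← h, Module.finrank_baseChange, map_mul, map_natCast])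
    (by rw [LinearMap.trace_baseChange]; simpa using h0) ((1:L) ⊗ₜ w)
    (by
      intro h1
      apply hw
      exact (Module.Flat.rTensor_preserves_injective_linearMap (M := V) (Algebra.linearMap F L) (algebraMap F L).injective).comp (TensorProduct.lid F V).symm.injective (by simpa using h1))
    (by simp [hσw])
  refine LinearMap.ext fun x => ?_
  have h1 := LinearMap.congr_fun key ((1:L) ⊗ₜ x)
  exact (Module.Flat.rTensor_preserves_injective_linearMap (M := V) (Algebra.linearMap F L) (algebraMap F L).injective).comp (TensorProduct.lid F V).symm.injective (by simpa using h1)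
end base13

section base14

theorem conj_sum {F : Type*} [Field F] [CharZero F] (M : ℕ) (hM : 0 < M) {κ : Type*} [Fintype κ] (d : κ → ℕ)
    (c : ∀ i, Fin (d i) → F) (hc : ∀ i j, c i j ^ M = 1)
    (h : ∑ i, (∑ j, c i j) * (∑ j, c i j ^ (M-1)) = 0) (i : κ) : ∑ j, c i j = 0 := by
  let E := algebraicClosure ℚ F
  have hmem : ∀ i j, c i j ∈ E := by
    intro i j
    rw [mem_algebraicClosure_iff]
    refine IsIntegral.isAlgebraic ⟨Polynomial.X ^ M - 1, ?_, by simp [hc i j]⟩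
    exact Polynomial.monic_X_pow_sub_C 1 hM.ne'
  let c' : ∀ i, Fin (d i) → E := fun i j => ⟨c i j, hmem i j⟩
  have hinj : Function.Injective (algebraMap E F) := (algebraMap E F).injective
  have hcc : ∀ i j, algebraMap E F (c' i j) = c i j := fun i j => rfl
  have hc' : ∀ i j, c' i j ^ M = 1 := fun i j => by apply hinj; rw [map_pow, hcc, hc, map_one]
  have h' : ∑ i, (∑ j, c' i j) * (∑ j, c' i j ^ (M-1)) = 0 := by
    apply hinj
    simp only [map_sum, map_mul, map_pow, hcc, h, map_zero]
  have halg : Algebra.IsAlgebraic ℚ E := algebraicClosure.isAlgebraic ℚ F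
  let φ : E →+* ℂ := (IsAlgClosed.lift (R := ℚ) : E →ₐ[ℚ] ℂ).toRingHom
  have hconj : ∀ i j, (starRingEnd ℂ) (φ (c' i j)) = φ (c' i j) ^ (M-1) := by
    intro i j
    have h1 : φ (c' i j) ^ M = 1 := by rw [← map_pow, hc', map_one]
    have h2 := Complex.norm_eq_one_of_pow_eq_one h1 hM.ne'
    have h3 : φ (c' i j) * (starRingEnd ℂ) (φ (c' i j)) = 1 := by
      rw [Complex.mul_conj, Complex.normSq_eq_norm_sq, h2]; simp
    have h4 : φ (c' i j) * φ (c' i j) ^ (M-1) = 1 := by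
      rw [← pow_succ', Nat.sub_add_cancel hM, h1]
    have h5 : φ (c' i j) ≠ 0 := fun h0 => by rw [h0] at h3; simp at h3
    exact mul_left_cancel₀ h5 (h3.trans h4.symm)
  have h2 : ∑ i, ‖φ (∑ j, c' i j)‖ ^ 2 = 0 := by
    have h3 := congrArg φ h'
    rw [map_zero, map_sum] at h3
    have h4 : ∀ i, φ ((∑ j, c' i j) * (∑ j, c' i j ^ (M-1))) = ((‖φ (∑ j, c' i j)‖ ^ 2 : ℝ) : ℂ) := by
      intro i
      rw [← Complex.normSq_eq_norm_sq, ← Complex.mul_conj, map_mul]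
      simp only [map_sum, map_pow, hconj]
    simp only [h4] at h3
    exact_mod_cast h3
  have h3 := (Finset.sum_eq_zero_iff_of_nonneg (fun i _ => by positivity)).1 h2 i (Finset.mem_univ i)
  have h4 : ∑ j, c' i j = 0 := by
    apply φ.injective
    rw [map_zero]
    simpa using h3
  have := congrArg (algebraMap E F) h4
  rw [map_sum, map_zero] at this
  exact this

theorem mat_eig {F : Type*} [Field F] [CharZero F] [IsAlgClosed F] (n : ℕ) (X : Matrix (Fin n) (Fin n) F)
    (M : ℕ) (hM : 0 < M) (hX : X ^ M = 1) :
    ∃ c : Fin n → F, (∀ j, c j ^ M = 1) ∧ X.trace = ∑ j, c j ∧ (X ^ (M-1)).trace = ∑ j, c j ^ (M-1) := by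
  let f : Module.End F (Fin n → F) := Matrix.toLinAlgEquiv' X
  have hf : f ^ M = 1 := by
    change (Matrix.toLinAlgEquiv' X) ^ M = _
    rw [← map_pow, hX, map_one]
  obtain ⟨b, c, hb, hc⟩ := exists_eigbasis f M hM (by rw [pow_succ, hf, one_mul])
  have hn : Module.finrank F (Fin n → F) = n := by simp
  have hc1 : ∀ i, c i ^ M = 1 := by
    intro i
    have h1 := eig_pow f b c hb M i
    rw [hf, Module.End.one_apply] at h1
    refine (smul_left_injective F (b.ne_zero i) ?_)
    simpa using h1.symm
  have ht : ∀ Y : Matrix (Fin n) (Fin n) F, Y.trace = LinearMap.trace F _ (Matrix.toLinAlgEquiv' Y) := by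
    intro Y
    exact (Matrix.trace_toLin'_eq Y).symm
  refine ⟨fun j => c (Fin.cast hn.symm j), fun j => hc1 _, ?_, ?_⟩
  · rw [ht, eig_trace f b c hb]
    exact (Fintype.sum_equiv (finCongr hn.symm) _ _ (fun _ => rfl)).symm
  · rw [ht, map_pow, eig_trace (f ^ (M-1)) b (fun i => c i ^ (M-1)) (eig_pow f b c hb _)]
    exact (Fintype.sum_equiv (finCongr hn.symm) _ _ (fun _ => rfl)).symm

theorem trace_pi_mat {F : Type*} [Field F] {m : ℕ} (d : Fin m → ℕ)
    (v u : Π i, Matrix (Fin (d i)) (Fin (d i)) F) :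
    LinearMap.trace F (Π i, Matrix (Fin (d i)) (Fin (d i)) F) (LinearMap.mulLeft F v ∘ₗ LinearMap.mulRight F u)
      = ∑ i, (u i).trace * (v i).trace := by
  classical
  let b := Pi.basis (fun i => Matrix.stdBasis F (Fin (d i)) (Fin (d i)))
  rw [LinearMap.trace_eq_matrix_trace F b, Matrix.trace, Fintype.sum_sigma]
  refine Finset.sum_congr rfl fun i _ => ?_
  have h : ∀ p : Fin (d i) × Fin (d i), ((LinearMap.toMatrix b b) (LinearMap.mulLeft F v ∘ₗ LinearMap.mulRight F u)).diag ⟨i, p⟩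
      = u i p.2 p.2 * v i p.1 p.1 := by
    rintro ⟨p, q⟩
    rw [Matrix.diag_apply, LinearMap.toMatrix_apply]
    simp only [b, Pi.basis_repr, Pi.basis_apply, LinearMap.comp_apply, LinearMap.mulLeft_apply, LinearMap.mulRight_apply,
      Pi.mul_apply, Pi.single_eq_same, Matrix.stdBasis_eq_single]
    have h2 : ∀ (Y : Matrix (Fin (d i)) (Fin (d i)) F), (Matrix.stdBasis F (Fin (d i)) (Fin (d i))).repr Y (p,q) = Y p q := by
      intro Y; rfl
    rw [h2, ← mul_assoc, Matrix.mul_apply, Finset.sum_eq_single q]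
    · simp [mul_comm]
    · intro j _ hj
      rw [Matrix.mul_single_apply_of_ne _ _ _ _ _ hj, zero_mul]
    · simp
  simp only [h]
  rw [Fintype.sum_prod_type, Finset.sum_comm, Matrix.trace, Matrix.trace, Finset.sum_mul_sum]
  rfl

theorem functional_mat {F : Type*} [Field F] {n : ℕ} (τ : Matrix (Fin n) (Fin n) F →ₗ[F] F)
    (hτ : ∀ x y, τ (x * y) = τ (y * x)) (X : Matrix (Fin n) (Fin n) F) (hX : X.trace = 0) : τ X = 0 := by
  classical
  rcases n with _ | n
  · have : X = 0 := Subsingleton.elim _ _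
    rw [this, map_zero]
  have h1 : ∀ i j (a : F), τ (Matrix.single i j a) = if i = j then a * τ (Matrix.single 0 0 1) else 0 := by
    intro i j a
    have h2 : Matrix.single i j a = Matrix.single i 0 a * (Matrix.single 0 j 1 : Matrix (Fin (n+1)) (Fin (n+1)) F) := by simp
    rw [h2, hτ]
    split_ifs with h
    · subst h
      rw [Matrix.single_mul_single_same, ← smul_eq_mul a (τ _), ← map_smul]; simp
    · rw [Matrix.single_mul_single_of_ne _ _ _ _ (Ne.symm h), map_zero]
  generalize τ (Matrix.single 0 0 1) = t at h1
  have h3 := congrArg τ (Matrix.matrix_eq_sum_single X)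
  rw [h3]
  simp only [map_sum, h1]
  simp only [Finset.sum_ite_eq, Finset.mem_univ, if_true]
  rw [← Finset.sum_mul]
  change X.trace * _ = 0
  rw [hX, zero_mul]

theorem functional_pi {F : Type*} [Field F] {m : ℕ} (d : Fin m → ℕ)
    (τ : (Π i, Matrix (Fin (d i)) (Fin (d i)) F) →ₐ[F] F)
    (u : Π i, Matrix (Fin (d i)) (Fin (d i)) F) (hu : ∀ i, (u i).trace = 0) : τ u = 0 := by
  classical
  have h : u = ∑ i, Pi.single i (u i) := (Finset.univ_sum_single u).symm
  rw [h, map_sum]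
  refine Finset.sum_eq_zero fun i _ => ?_
  refine functional_mat (τ.toLinearMap ∘ₗ LinearMap.single F (fun i => Matrix (Fin (d i)) (Fin (d i)) F) i) ?_ (u i) (hu i)
  intro x y
  simp only [LinearMap.comp_apply, LinearMap.coe_single, AlgHom.toLinearMap_apply]
  rw [Pi.single_mul, Pi.single_mul, map_mul, map_mul, mul_comm]

theorem pos_F {F C : Type*} [Field F] [CharZero F] [IsAlgClosed F] [Ring C] [Algebra F C] [FiniteDimensional F C]
    [IsSemisimpleRing C] (M : ℕ) (hM : 0 < M) (u : C) (hu : u ^ M = 1) (ε : C →ₐ[F] F) :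
    LinearMap.trace F C (LinearMap.mulLeft F (u ^ (M-1)) ∘ₗ LinearMap.mulRight F u) ≠ 0 := by
  intro h0
  obtain ⟨m, d, -, ⟨e⟩⟩ := IsSemisimpleRing.exists_algEquiv_pi_matrix_of_isAlgClosed F C
  rw [← LinearMap.trace_conj' _ e.toLinearEquiv] at h0
  have h1 : e.toLinearEquiv.conj (LinearMap.mulLeft F (u ^ (M-1)) ∘ₗ LinearMap.mulRight F u)
      = LinearMap.mulLeft F (e u ^ (M-1)) ∘ₗ LinearMap.mulRight F (e u) := by
    refine LinearMap.ext fun x => ?_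
    simp [LinearEquiv.conj_apply]
  rw [h1, trace_pi_mat] at h0
  have heu : ∀ i, (e u i) ^ M = 1 := by
    intro i
    rw [← Pi.pow_apply, ← map_pow, hu, map_one]; rfl
  choose c hc1 hc2 hc3 using fun i => mat_eig (d i) (e u i) M hM (heu i)
  have h2 := conj_sum M hM d c hc1 (by simpa only [Pi.pow_apply, hc2, hc3] using h0)
  have h3 := functional_pi d (ε.comp e.symm.toAlgHom) (e u) (fun i => by rw [hc2, h2])
  have h4 : ε u = 0 := by simpa using h3
  have h5 := congrArg ε hu
  rw [map_pow, h4, zero_pow hM.ne', map_one] at h5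
  exact zero_ne_one h5

end base14

section base15
universe v
variable {K : Type*} {A : Type v} [Field K] [CharZero K] [Ring A] [Algebra K A] [FiniteDimensional K A]

theorem tform_nondeg [IsSemisimpleRing A] (x : A)
    (hx : ∀ y, LinearMap.trace K A (LinearMap.mulLeft K (x * y)) = 0) : x = 0 := by
  let I : Ideal A :=
    { carrier := {x | ∀ y, LinearMap.trace K A (LinearMap.mulLeft K (x * y)) = 0}
      add_mem' := by
        intro a b ha hb y
        have h : LinearMap.mulLeft K ((a + b) * y) = LinearMap.mulLeft K (a * y) + LinearMap.mulLeft K (b * y) := by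
          ext z; simp [add_mul, mul_assoc]
        rw [h, map_add, ha, hb, add_zero]
      zero_mem' := by intro y; simp
      smul_mem' := by
        intro z a ha y
        rw [smul_eq_mul, mul_assoc, LinearMap.mulLeft_mul, ← Module.End.mul_eq_comp, LinearMap.trace_mul_comm,
          Module.End.mul_eq_comp, ← LinearMap.mulLeft_mul, mul_assoc]
        exact ha _ }
  obtain ⟨e, he, hI⟩ := IsSemisimpleRing.ideal_eq_span_idempotent I
  have heI : e ∈ I := by rw [hI]; exact Ideal.mem_span_singleton_self e
  have h1 : LinearMap.trace K A (LinearMap.mulLeft K e) = 0 := by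
    have := heI 1
    rwa [mul_one] at this
  have h2 : IsIdempotentElem (LinearMap.mulLeft K e : Module.End K A) := by
    change _ ∘ₗ _ = _
    rw [← LinearMap.mulLeft_mul, he]
  have h3 := (LinearMap.IsIdempotentElem.trace_eq_zero_iff h2).1 h1
  have he0 : e = 0 := by simpa using LinearMap.congr_fun h3 1
  have hxI : x ∈ I := hx
  rw [hI, he0] at hxI
  simpa using hxI

theorem semisimple_baseChange [IsSemisimpleRing A] (L : Type*) [Field L] [CharZero L] [Algebra K L] :
    IsSemisimpleRing (L ⊗[K] A) := by
  classical
  let T : A →ₗ[K] Module.Dual K A := LinearMap.compr₂ (LinearMap.mul K A) (LinearMap.trace K A ∘ₗ (LinearMap.mul K A))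
  have hT : ∀ x y, T x y = LinearMap.trace K A (LinearMap.mulLeft K (x*y)) := fun x y => rfl
  have hTi : Function.Injective T := by
    rw [injective_iff_map_eq_zero]
    intro x hx
    exact tform_nondeg (K := K) x fun y => by rw [← hT, hx]; rfl
  let Te : A ≃ₗ[K] Module.Dual K A := LinearEquiv.ofInjectiveOfFinrankEq T hTi (by simp)
  let b := Module.finBasis K A
  -- dual elements
  have hTsymm : ∀ x y, T x y = T y x := by
    intro x y
    rw [hT, hT, LinearMap.mulLeft_mul, LinearMap.mulLeft_mul, ← Module.End.mul_eq_comp, LinearMap.trace_mul_comm]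
    rfl
  let q := fun i => Te.symm (b.coord i)
  have hq : ∀ i x, T x (q i) = b.coord i x := by
    intro i x
    rw [hTsymm]
    exact LinearMap.congr_fun (Te.apply_symm_apply (b.coord i)) x
  let T' : L ⊗[K] A →ₗ[L] L := LinearMap.trace L (L ⊗[K] A) ∘ₗ (LinearMap.mul L (L ⊗[K] A))
  have hT' : ∀ l a, T' (l ⊗ₜ a) = l * algebraMap K L (LinearMap.trace K A (LinearMap.mulLeft K a)) := by
    intro l a
    have h1 : LinearMap.mul L (L ⊗[K] A) (l ⊗ₜ a) = l • (LinearMap.mulLeft K a).baseChange L := by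
      refine TensorProduct.AlgebraTensorModule.ext fun l' a' => ?_
      simp [TensorProduct.smul_tmul']
    rw [LinearMap.comp_apply, h1, map_smul, LinearMap.trace_baseChange, smul_eq_mul]
  have hrec : ∀ x : L ⊗[K] A, x = ∑ i, T' (x * ((1:L) ⊗ₜ q i)) • ((1:L) ⊗ₜ[K] b i) := by
    intro x
    induction x using TensorProduct.induction_on with
    | zero => simp
    | add x y hx hy =>
      simp only [add_mul, map_add, add_smul, Finset.sum_add_distrib]
      rw [← hx, ← hy]
    | tmul l a =>
      simp only [Algebra.TensorProduct.tmul_mul_tmul, mul_one, hT', ← hT, hq, TensorProduct.smul_tmul', smul_eq_mul]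
      conv_lhs => rw [← b.sum_repr a, TensorProduct.tmul_sum]
      refine Finset.sum_congr rfl fun i _ => ?_
      rw [TensorProduct.tmul_smul, TensorProduct.smul_tmul', Algebra.smul_def, mul_comm]
      simp
  have hart : IsArtinianRing (L ⊗[K] A) := IsArtinianRing.of_finite L _
  rw [IsArtinianRing.isSemisimpleRing_iff_jacobson, eq_bot_iff]
  intro x hx
  rw [Submodule.mem_bot, hrec x]
  refine Finset.sum_eq_zero fun i _ => ?_
  have h1 : x * ((1:L) ⊗ₜ[K] q i) ∈ Ring.jacobson (L ⊗[K] A) := Ideal.mul_mem_right _ _ hx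
  obtain ⟨n, hn⟩ := IsSemiprimaryRing.isNilpotent (R := L ⊗[K] A)
  have h2 : (x * ((1:L) ⊗ₜ[K] q i)) ^ n = 0 := by
    have := Ideal.pow_mem_pow h1 n
    rw [hn] at this
    simpa using this
  have h3 : IsNilpotent (LinearMap.mul L (L ⊗[K] A) (x * ((1:L) ⊗ₜ[K] q i))) := by
    refine ⟨n, ?_⟩
    change (Algebra.lmul L (L ⊗[K] A) (x * ((1:L) ⊗ₜ[K] q i))) ^ n = 0
    rw [← map_pow, h2, map_zero]
  have h4 : T' (x * ((1:L) ⊗ₜ[K] q i)) = 0 := (LinearMap.isNilpotent_trace_of_isNilpotent h3).eq_zero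
  rw [h4, zero_smul]

theorem pos_K [IsSemisimpleRing A] (M : ℕ) (hM : 0 < M) (u : A) (hu : u ^ M = 1) (ε : A →ₐ[K] K) :
    LinearMap.trace K A (LinearMap.mulLeft K (u ^ (M-1)) ∘ₗ LinearMap.mulRight K u) ≠ 0 := by
  let L := AlgebraicClosure K
  have : CharZero L := charZero_of_injective_algebraMap (algebraMap K L).injective
  have : IsSemisimpleRing (L ⊗[K] A) := semisimple_baseChange L
  let ε' : L ⊗[K] A →ₐ[L] L := Algebra.TensorProduct.lift (AlgHom.id L L) ((Algebra.ofId K L).comp ε) (fun _ _ => Commute.all _ _)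
  have h := pos_F (F := L) (C := L ⊗[K] A) M hM ((1:L) ⊗ₜ u) (by rw [Algebra.TensorProduct.tmul_pow, hu, one_pow]; rfl) ε'
  have h1 : LinearMap.mulLeft L (((1:L) ⊗ₜ[K] u) ^ (M-1)) ∘ₗ LinearMap.mulRight L ((1:L) ⊗ₜ[K] u)
      = (LinearMap.mulLeft K (u ^ (M-1)) ∘ₗ LinearMap.mulRight K u).baseChange L := by
    refine TensorProduct.AlgebraTensorModule.ext fun l' a' => ?_
    simp [Algebra.TensorProduct.tmul_pow]
  rw [h1, LinearMap.trace_baseChange] at h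
  intro h0
  rw [h0, map_zero] at h
  exact h rfl

end base15

section base16
universe v
variable {K : Type*} {A : Type v} [Field K] [CharZero K] [Ring A] [HopfAlgebra K A] [FiniteDimensional K A]
  [IsSemisimpleRing A]

theorem Sinv_sq (Sinv : A →ₗ[K] A) (hS1 : ∀ x, Sinv (HopfAlgebra.antipode K (A := A) x) = x)
    (hS2 : ∀ x, HopfAlgebra.antipode K (A := A) (Sinv x) = x) (u : A) (M : ℕ) (hM : 0 < M) (hu : u ^ M = 1)
    (hsu : ∀ x, HopfAlgebra.antipode K (A := A) (HopfAlgebra.antipode K (A := A) x) * u = u * x) :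
    Sinv ∘ₗ Sinv = LinearMap.id := by
  have huv : u * u ^ (M-1) = 1 := by rw [← pow_succ', Nat.sub_add_cancel hM, hu]
  have hvu : u ^ (M-1) * u = 1 := by rw [← pow_succ, Nat.sub_add_cancel hM, hu]
  have hσ : ∀ x, Sinv (Sinv x) = u ^ (M-1) * x * u := by
    intro x
    have h := hsu (Sinv (Sinv x))
    rw [hS2, hS2] at h
    rw [mul_assoc, h, ← mul_assoc, hvu, one_mul]
  obtain ⟨hσM, B, hB, htr⟩ := traceData Sinv hS1 hS2 u (u ^ (M-1)) huv hσ M hu (by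
    rw [← pow_mul, mul_comm, pow_mul, hu, one_pow])
  have hσ' : Sinv ∘ₗ Sinv = LinearMap.mulLeft K (u ^ (M-1)) ∘ₗ LinearMap.mulRight K u := by
    refine LinearMap.ext fun x => ?_
    rw [LinearMap.comp_apply, hσ, mul_assoc]; rfl
  have hpos : LinearMap.trace K A (Sinv ∘ₗ Sinv) ≠ 0 := by
    rw [hσ']
    exact pos_K M hM u hu (Bialgebra.counitAlgHom K A)
  have h1 : (1:A) ≠ 0 := by
    intro h0
    have h2 := congrArg (Coalgebra.counit (R := K) (A := A)) h0
    rw [Bialgebra.counit_one, map_zero] at h2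
    exact one_ne_zero h2
  exact arith_K (Sinv ∘ₗ Sinv) B M hM hσM hB htr hpos 1 h1 (by rw [LinearMap.comp_apply, hσ, mul_one, hvu])
end base16

theorem final_main {k H : Type*} [Field k] [CharZero k]
    [Ring H] [HopfAlgebra k H] [FiniteDimensional k H] [IsSemisimpleRing H]
    (Sinv : H →ₗ[k] H)
    (hS1 : Sinv ∘ₗ HopfAlgebra.antipode (R := k) (A := H) = LinearMap.id)
    (hS2 : HopfAlgebra.antipode (R := k) (A := H) ∘ₗ Sinv = LinearMap.id)
    (R : H ⊗[k] H) (hRunit : IsUnit R)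
    (hR1 : TensorProduct.map (Coalgebra.comul (R := k)) LinearMap.id R
      = (TensorProduct.map ((TensorProduct.mk k H H).flip 1) LinearMap.id R)
        * (TensorProduct.map (TensorProduct.mk k H H 1) LinearMap.id R))
    (hR2 : (TensorProduct.assoc k H H H).symm
        (TensorProduct.map LinearMap.id (Coalgebra.comul (R := k)) R)
      = (TensorProduct.map ((TensorProduct.mk k H H).flip 1) LinearMap.id R)
        * (R ⊗ₜ[k] (1 : H)))
    (hR3 : ∀ x : H, R * Coalgebra.comul (R := k) x
      = TensorProduct.comm k H H (Coalgebra.comul (R := k) x) * R)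
    (hR4 : TensorProduct.comm k H H R * R = 1) :
    hopfExponent k H Sinv ≠ 0 ∧ hopfExponent k H Sinv ∣ Module.finrank k H := by
  have hs1 : ∀ x, Sinv (HopfAlgebra.antipode k (A := H) x) = x := LinearMap.congr_fun hS1
  have hs2 : ∀ x, HopfAlgebra.antipode k (A := H) (Sinv x) = x := LinearMap.congr_fun hS2
  have hr1 := get_hr1 R hR1
  have hr2' := get_hr2' R hR2
  have h4' := get_h4' R hRunit hR4
  obtain ⟨u, M, hM, hu, -, hsu⟩ := exists_u R hr1 hr2' hR3 h4'
  have hsq := Sinv_sq Sinv hs1 hs2 u M hM hu hsu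
  have hSS : ∀ x, HopfAlgebra.antipode k (A := H) (HopfAlgebra.antipode k (A := H) x) = x := by
    intro x
    have h1 : Sinv (Sinv x) = x := LinearMap.congr_fun hsq x
    have h2 := hs2 (Sinv x)
    rw [h1] at h2
    rw [h2, hs2]
  exact exp_final Sinv hsq (GG_pow_eq_one hSS R hr1 (get_hr2 R hr2') hR3 hR4 h4' (get_hy R hr1 hR3)
    (get_hk R (S_R R hr1 h4') hR4 hSS))

/-- If `H` is a finite-dimensional semisimple triangular Hopf algebra over a field of
characteristic zero, then `exp(H)` is finite and divides `dim H`. -/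
theorem hopfExponent_dvd_dim_of_triangular {k H : Type*} [Field k] [CharZero k]
    [Ring H] [HopfAlgebra k H] [FiniteDimensional k H] [IsSemisimpleRing H]
    (Sinv : H →ₗ[k] H)
    (hS1 : Sinv ∘ₗ HopfAlgebra.antipode (R := k) (A := H) = LinearMap.id)
    (hS2 : HopfAlgebra.antipode (R := k) (A := H) ∘ₗ Sinv = LinearMap.id)
    (R : H ⊗[k] H) (hRunit : IsUnit R)
    -- `(Δ ⊗ id)(R) = R₁₃ R₂₃` in `(H ⊗ H) ⊗ H`
    (hR1 : TensorProduct.map (Coalgebra.comul (R := k)) LinearMap.id R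
      = (TensorProduct.map ((TensorProduct.mk k H H).flip 1) LinearMap.id R)
        * (TensorProduct.map (TensorProduct.mk k H H 1) LinearMap.id R))
    -- `(id ⊗ Δ)(R) = R₁₃ R₁₂` in `(H ⊗ H) ⊗ H`
    (hR2 : (TensorProduct.assoc k H H H).symm
        (TensorProduct.map LinearMap.id (Coalgebra.comul (R := k)) R)
      = (TensorProduct.map ((TensorProduct.mk k H H).flip 1) LinearMap.id R)
        * (R ⊗ₜ[k] (1 : H)))
    -- `R Δ(x) = Δᵒᵖ(x) R` for all `x`
    (hR3 : ∀ x : H, R * Coalgebra.comul (R := k) x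
      = TensorProduct.comm k H H (Coalgebra.comul (R := k) x) * R)
    -- triangularity: `R₂₁ R = 1`
    (hR4 : TensorProduct.comm k H H R * R = 1) :
    hopfExponent k H Sinv ≠ 0 ∧ hopfExponent k H Sinv ∣ Module.finrank k H := by
  exact final_main Sinv hS1 hS2 R hRunit hR1 hR2 hR3 hR4

end
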